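/- For every real α ≥ 1.04 there exists a C^∞-smooth real-valued function μ on D̄ with μ(z) ≤ 2α/(1−|z|²)² for all z ∈ D (i.e. μ dΣ + (α/2)·K_ℍ ≤ 0), such that there is no strictly positive C^∞-smooth weight ω₀ on D̄ satisfying simultaneously: Δ log ω₀(z) = −μ(z)/2 for z ∈ D, ∫_D ω₀ dΣ = 1, and ω₀(0) ≥ ω(0) for every strictly positive C^∞-smooth weight ω on D̄ with Δ log ω = −μ/2 on D and ∫_D ω dΣ = 1. -/

import Mathlib

open Complex MeasureTheory Metric Set

noncomputable section

/-- The open unit disk in ℂ. -/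
def unitDisk : Set ℂ := Metric.ball 0 1

/-- The closed unit disk in ℂ. -/
def closedDisk : Set ℂ := Metric.closedBall 0 1

/-- The unit circle in ℂ. -/
def unitCircle : Set ℂ := Metric.sphere 0 1

/-- The normalized area measure dΣ = dx dy / π on ℂ. -/
def dSigma : Measure ℂ := (ENNReal.ofReal (1 / Real.pi)) • (volume : Measure ℂ)

/-- The normalized Laplacian Δ = (1/4)(∂²ₓ + ∂²_y) of a real-valued function on ℂ. -/
def lapR (u : ℂ → ℝ) (z : ℂ) : ℝ :=
  (1/4) * (fderiv ℝ (fun w => fderiv ℝ u w 1) z 1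
    + fderiv ℝ (fun w => fderiv ℝ u w Complex.I) z Complex.I)

/-- The normalized Laplacian Δ = (1/4)(∂²ₓ + ∂²_y) of a complex-valued function on ℂ. -/
def lapC (u : ℂ → ℂ) (z : ℂ) : ℂ :=
  (1/4) * (fderiv ℝ (fun w => fderiv ℝ u w 1) z 1
    + fderiv ℝ (fun w => fderiv ℝ u w Complex.I) z Complex.I)

/-- Membership in the weighted Bergman space A²(𝔻, ω): holomorphic on the unit disk
and square integrable against the weight ω with respect to dΣ. -/
def MemA2 (ω : ℂ → ℝ) (f : ℂ → ℂ) : Prop :=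
  DifferentiableOn ℂ f unitDisk ∧
    IntegrableOn (fun z => ‖f z‖ ^ 2 * ω z) unitDisk dSigma

/-- `k` reproduces at `w` for the weight `ω`. -/
def Reproduces (ω : ℂ → ℝ) (k : ℂ → ℂ) (w : ℂ) : Prop :=
  MemA2 ω k ∧ ∀ f : ℂ → ℂ, MemA2 ω f →
    ∫ z in unitDisk, f z * (starRingEnd ℂ) (k z) * (ω z : ℂ) ∂dSigma = f w

/-- A bounded (complex-valued) harmonic function on the unit disk. -/
def BoundedHarmonicC (h : ℂ → ℂ) : Prop :=
  ContDiffOn ℝ 2 h unitDisk ∧ (∀ z ∈ unitDisk, lapC h z = 0) ∧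
    ∃ M : ℝ, ∀ z ∈ unitDisk, ‖h z‖ ≤ M

/-- A bounded real-valued harmonic function on the unit disk. -/
def BoundedHarmonicR (h : ℂ → ℝ) : Prop :=
  ContDiffOn ℝ 2 h unitDisk ∧ (∀ z ∈ unitDisk, lapR h z = 0) ∧
    ∃ M : ℝ, ∀ z ∈ unitDisk, |h z| ≤ M

/-- The profile of the weight in strip coordinates. -/
def rhoS (B b θ : ℝ) : ℝ := Real.cos θ + (1/300) * Real.cos (3*θ) + B * Real.cosh (b*θ)

/-- Cosine transform of the profile. -/
def rS (B b y : ℝ) : ℝ :=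
  ∫ θ in (-(Real.pi/2))..(Real.pi/2), rhoS B b θ * Real.cos (2*y*θ)

/-- The main part of the transform. -/
def baseS (y : ℝ) : ℝ :=
  ∫ θ in (-(Real.pi/2))..(Real.pi/2),
    (Real.cos θ + (1/300) * Real.cos (3*θ)) * Real.cos (2*y*θ)

lemma S3_int_cos {k : ℝ} (hk : k ≠ 0) :
    ∫ θ in (-(Real.pi/2))..(Real.pi/2), Real.cos (k*θ) = 2 * Real.sin (k*(Real.pi/2)) / k := by
  rw [intervalIntegral.integral_comp_mul_left (fun x => Real.cos x) hk, integral_cos]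
  have : k * -(Real.pi/2) = -(k*(Real.pi/2)) := by ring
  rw [this, Real.sin_neg, smul_eq_mul]
  field_simp; ring

lemma S3_int_coscos {k l : ℝ} (h1 : k + l ≠ 0) (h2 : k - l ≠ 0) :
    ∫ θ in (-(Real.pi/2))..(Real.pi/2), Real.cos (k*θ) * Real.cos (l*θ)
      = Real.sin ((k+l)*(Real.pi/2)) / (k+l) + Real.sin ((k-l)*(Real.pi/2)) / (k-l) := by
  have : ∀ θ : ℝ, Real.cos (k*θ) * Real.cos (l*θ)
      = (1/2) * Real.cos ((k+l)*θ) + (1/2) * Real.cos ((k-l)*θ) := by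
    intro θ
    rw [add_mul, sub_mul, Real.cos_add, Real.cos_sub]; ring
  simp_rw [this]
  rw [intervalIntegral.integral_add (Continuous.intervalIntegrable (by fun_prop) _ _)
    (Continuous.intervalIntegrable (by fun_prop) _ _), intervalIntegral.integral_const_mul,
    intervalIntegral.integral_const_mul, S3_int_cos h1, S3_int_cos h2]
  ring

lemma S3_int_cossq {k : ℝ} (h1 : k ≠ 0) :
    ∫ θ in (-(Real.pi/2))..(Real.pi/2), Real.cos (k*θ) * Real.cos (k*θ)
      = Real.sin (k*Real.pi) / (2*k) + Real.pi/2 := by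
  have : ∀ θ : ℝ, Real.cos (k*θ) * Real.cos (k*θ)
      = (1/2) * Real.cos ((2*k)*θ) + (1/2) := by
    intro θ
    rw [mul_assoc 2, Real.cos_two_mul]; ring
  simp_rw [this]
  rw [intervalIntegral.integral_add (Continuous.intervalIntegrable (by fun_prop) _ _)
    (Continuous.intervalIntegrable (by fun_prop) _ _), intervalIntegral.integral_const_mul,
    S3_int_cos (by positivity)]
  have : 2*k*(Real.pi/2) = k*Real.pi := by ring
  rw [this]
  simp; field_simp

lemma baseS_split (y : ℝ) : baseS y =
    (∫ θ in (-(Real.pi/2))..(Real.pi/2), Real.cos (1*θ) * Real.cos ((2*y)*θ))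
    + (1/300) * ∫ θ in (-(Real.pi/2))..(Real.pi/2), Real.cos (3*θ) * Real.cos ((2*y)*θ) := by
  unfold baseS
  rw [← intervalIntegral.integral_const_mul, ← intervalIntegral.integral_add
    (Continuous.intervalIntegrable (by fun_prop) _ _)
    (Continuous.intervalIntegrable (by fun_prop) _ _)]
  congr 1; ext θ; rw [one_mul]; ring

lemma baseS_cont : Continuous baseS := by
  unfold baseS
  apply intervalIntegral.continuous_parametric_intervalIntegral_of_continuous' (by fun_prop)

lemma baseS_formula {y : ℝ} (h0 : 0 ≤ y) (h1 : y ≠ 1/2) (h3 : y ≠ 3/2) :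
    baseS y = Real.cos (Real.pi*y) * (2/(1-4*y^2) - (1/50)/(9-4*y^2)) := by
  have a1 : (1:ℝ) - 2*y ≠ 0 := fun h => h1 (by linarith)
  have a3 : (3:ℝ) - 2*y ≠ 0 := fun h => h3 (by linarith)
  have b1 : (1:ℝ) + 2*y ≠ 0 := by positivity
  have b3 : (3:ℝ) + 2*y ≠ 0 := by positivity
  rw [baseS_split, S3_int_coscos b1 a1, S3_int_coscos b3 a3]
  have e1 : Real.sin ((1+2*y)*(Real.pi/2)) = Real.cos (Real.pi*y) := by
    rw [show (1+2*y)*(Real.pi/2) = Real.pi*y + Real.pi/2 by ring, Real.sin_add_pi_div_two]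
  have e2 : Real.sin ((1-2*y)*(Real.pi/2)) = Real.cos (Real.pi*y) := by
    rw [show (1-2*y)*(Real.pi/2) = Real.pi/2 - Real.pi*y by ring, Real.sin_pi_div_two_sub]
  have e3 : Real.sin ((3+2*y)*(Real.pi/2)) = -Real.cos (Real.pi*y) := by
    rw [show (3+2*y)*(Real.pi/2) = (Real.pi*y + Real.pi/2) + Real.pi by ring, Real.sin_add_pi,
      Real.sin_add_pi_div_two]
  have e4 : Real.sin ((3-2*y)*(Real.pi/2)) = -Real.cos (Real.pi*y) := by
    rw [show (3-2*y)*(Real.pi/2) = (Real.pi/2 - Real.pi*y) + Real.pi by ring, Real.sin_add_pi,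
      Real.sin_pi_div_two_sub]
  rw [e1, e2, e3, e4]
  have c1 : (1:ℝ) - 4*y^2 ≠ 0 := by
    rw [show (1:ℝ) - 4*y^2 = (1+2*y)*(1-2*y) by ring]; exact mul_ne_zero b1 a1
  have c3 : (9:ℝ) - 4*y^2 ≠ 0 := by
    rw [show (9:ℝ) - 4*y^2 = (3+2*y)*(3-2*y) by ring]; exact mul_ne_zero b3 a3
  have f1 : 2/((1:ℝ) - 4*y^2) = 1/(1+2*y) + 1/(1-2*y) := by
    rw [div_add_div _ _ b1 a1, show (1:ℝ) - 4*y^2 = (1+2*y)*(1-2*y) by ring]; ring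
  have f3 : (1/50)/((9:ℝ) - 4*y^2) = (1/300)*(1/(3+2*y) + 1/(3-2*y)) := by
    rw [div_add_div _ _ b3 a3, show (9:ℝ) - 4*y^2 = (3+2*y)*(3-2*y) by ring]; ring
  rw [f1, f3]; ring

lemma baseS_half : baseS (1/2) = Real.pi/2 := by
  rw [baseS_split]
  have : (2:ℝ)*(1/2) = 1 := by norm_num
  rw [this, S3_int_cossq one_ne_zero, S3_int_coscos (by norm_num) (by norm_num)]
  rw [show ((3:ℝ)+1)*(Real.pi/2) = 2*Real.pi by ring, show ((3:ℝ)-1)*(Real.pi/2) = Real.pi by ring]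
  simp

lemma baseS_three_half : baseS (3/2) = Real.pi/600 := by
  rw [baseS_split]
  have : (2:ℝ)*(3/2) = 3 := by norm_num
  rw [this, S3_int_cossq (by norm_num), S3_int_coscos (by norm_num) (by norm_num)]
  rw [show ((1:ℝ)+3)*(Real.pi/2) = 2*Real.pi by ring, show ((1:ℝ)-3)*(Real.pi/2) = -Real.pi by ring,
    show (3:ℝ)*Real.pi = Real.pi + 2*Real.pi by ring, Real.sin_add_two_pi]
  simp; ring

lemma S3_cos_three_half : Real.cos (Real.pi*(3/2)) = 0 := by
  rw [show Real.pi*(3/2) = Real.pi/2 + Real.pi by ring, Real.cos_add_pi]; simp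

lemma baseS_pos {y : ℝ} (h0 : 0 ≤ y) (h1 : y ≤ 9/4) :
    0 < (1/4) * Real.cos (Real.pi*y) + baseS y := by
  have hpi := Real.pi_pos
  by_cases e1 : y = 1/2
  · subst e1
    rw [baseS_half, show Real.pi*(1/2) = Real.pi/2 by ring, Real.cos_pi_div_two]; positivity
  by_cases e3 : y = 3/2
  · subst e3
    rw [baseS_three_half, S3_cos_three_half]; positivity
  rw [baseS_formula h0 e1 e3]
  have a1 : (1:ℝ) - 2*y ≠ 0 := fun h => e1 (by linarith)
  have a3 : (3:ℝ) - 2*y ≠ 0 := fun h => e3 (by linarith)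
  have b1 : (1:ℝ) + 2*y ≠ 0 := by positivity
  have b3 : (3:ℝ) + 2*y ≠ 0 := by positivity
  have c1 : (1:ℝ) - 4*y^2 ≠ 0 := by
    rw [show (1:ℝ) - 4*y^2 = (1+2*y)*(1-2*y) by ring]; exact mul_ne_zero b1 a1
  have c3 : (9:ℝ) - 4*y^2 ≠ 0 := by
    rw [show (9:ℝ) - 4*y^2 = (3+2*y)*(3-2*y) by ring]; exact mul_ne_zero b3 a3
  have key : (1/4) * Real.cos (Real.pi*y)
      + Real.cos (Real.pi*y) * (2/(1-4*y^2) - (1/50)/(9-4*y^2))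
      = (Real.cos (Real.pi*y) / ((1-4*y^2)*(9-4*y^2))) *
        ((9-4*y^2)^2/4 - (1/50)*(1-4*y^2)) := by
    field_simp; ring
  rw [key]
  have hN : 0 < (9-4*y^2)^2/4 - (1/50)*(1-4*y^2) := by
    rcases le_or_gt y (1/2) with h | h
    · have : y^2 ≤ 1/4 := by nlinarith
      nlinarith [sq_nonneg y]
    · have : y^2 > 1/4 := by nlinarith
      nlinarith [sq_nonneg (9-4*y^2)]
  refine mul_pos ?_ hN
  rcases lt_or_gt_of_ne e1 with h | h
  · have : 0 < Real.cos (Real.pi*y) := Real.cos_pos_of_mem_Ioo ⟨by nlinarith, by nlinarith⟩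
    have h2 : 0 < 1 - 4*y^2 := by nlinarith
    have h3 : 0 < 9 - 4*y^2 := by nlinarith
    positivity
  rcases lt_or_gt_of_ne e3 with h' | h'
  · have : Real.cos (Real.pi*y) < 0 :=
      Real.cos_neg_of_pi_div_two_lt_of_lt (by nlinarith) (by nlinarith)
    have h2 : 1 - 4*y^2 < 0 := by nlinarith
    have h3 : 0 < 9 - 4*y^2 := by nlinarith
    exact div_pos_of_neg_of_neg this (mul_neg_of_neg_of_pos h2 h3)
  · have : 0 < Real.cos (Real.pi*y) := by
      rw [← Real.cos_sub_two_pi]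
      exact Real.cos_pos_of_mem_Ioo ⟨by nlinarith, by nlinarith⟩
    have h2 : 1 - 4*y^2 < 0 := by nlinarith
    have h3 : 9 - 4*y^2 < 0 := by nlinarith
    exact div_pos this (mul_pos_of_neg_of_neg h2 h3)

lemma S3_int_cosh {b : ℝ} (hb : 0 < b) (y : ℝ) :
    ∫ θ in (-(Real.pi/2))..(Real.pi/2), Real.cosh (b*θ) * Real.cos (2*y*θ)
     = (2*b*Real.sinh (b*(Real.pi/2))*Real.cos (Real.pi*y)
       + 4*y*Real.cosh (b*(Real.pi/2))*Real.sin (Real.pi*y))/(b^2+4*y^2) := by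
  have hD : b^2+4*y^2 ≠ 0 := by positivity
  have hder : ∀ θ : ℝ, HasDerivAt (fun θ => (b*Real.sinh (b*θ)*Real.cos (2*y*θ)
       + 2*y*Real.cosh (b*θ)*Real.sin (2*y*θ))/(b^2+4*y^2))
       (Real.cosh (b*θ) * Real.cos (2*y*θ)) θ := by
    intro θ
    have i1 : HasDerivAt (fun θ : ℝ => b*θ) b θ := by simpa using (hasDerivAt_id θ).const_mul b
    have i2 : HasDerivAt (fun θ : ℝ => 2*y*θ) (2*y) θ := by
      simpa using (hasDerivAt_id θ).const_mul (2*y)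
    have := (((i1.sinh.const_mul b).mul i2.cos).add ((i1.cosh.const_mul (2*y)).mul i2.sin)).div_const
      (b^2+4*y^2)
    refine this.congr_deriv ?_
    field_simp; ring
  rw [intervalIntegral.integral_eq_sub_of_hasDerivAt (fun θ _ => hder θ)
    (Continuous.intervalIntegrable (by fun_prop) _ _)]
  rw [show b * -(Real.pi/2) = -(b*(Real.pi/2)) by ring,
    show 2*y * -(Real.pi/2) = -(Real.pi*y) by ring, show 2*y * (Real.pi/2) = Real.pi*y by ring,
    Real.sinh_neg, Real.cosh_neg, Real.cos_neg, Real.sin_neg]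
  ring

lemma rS_eq {b : ℝ} (hb : 0 < b) (B y : ℝ) : rS B b y = baseS y + B *
    ((2*b*Real.sinh (b*(Real.pi/2))*Real.cos (Real.pi*y)
       + 4*y*Real.cosh (b*(Real.pi/2))*Real.sin (Real.pi*y))/(b^2+4*y^2)) := by
  rw [← S3_int_cosh hb, ← intervalIntegral.integral_const_mul]
  unfold rS baseS rhoS
  rw [← intervalIntegral.integral_add
    (Continuous.intervalIntegrable (by fun_prop) _ _)
    (Continuous.intervalIntegrable (by fun_prop) _ _)]
  congr 1; ext θ; ring

lemma rS_close {b : ℝ} (hb : 1 ≤ b) {y : ℝ} (h0 : 0 ≤ y) (h1 : y ≤ 9/4) :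
    |rS (b/(8*Real.sinh (b*(Real.pi/2)))) b y - ((1/4) * Real.cos (Real.pi*y) + baseS y)|
      ≤ 30/b := by
  have hb0 : 0 < b := by linarith
  rw [rS_eq hb0]
  set s := Real.sinh (b*(Real.pi/2)) with hs
  set C := Real.cosh (b*(Real.pi/2)) with hC
  have hx : 1 ≤ b*(Real.pi/2) := by nlinarith [Real.pi_gt_three]
  have hs1 : 1 ≤ s := hx.trans (Real.self_le_sinh_iff.2 (by linarith))
  have hC1 : C ≤ 2*s := by
    have h1 : C^2 = s^2+1 := Real.cosh_sq _
    have h2 : 0 < C := Real.cosh_pos _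
    nlinarith
  have hC0 : 0 < C := Real.cosh_pos _
  have hs0 : 0 < s := by linarith
  set cc := Real.cos (Real.pi*y)
  set ss := Real.sin (Real.pi*y)
  have hcc : |cc| ≤ 1 := Real.abs_cos_le_one _
  have hss : |ss| ≤ 1 := Real.abs_sin_le_one _
  have hD : 0 < b^2+4*y^2 := by positivity
  have : baseS y + b/(8*s) * ((2*b*s*cc+4*y*C*ss)/(b^2+4*y^2)) - ((1/4)*cc + baseS y)
    = (-(y^2)*cc + b*y*(C/(2*s))*ss)/(b^2+4*y^2) := by
    field_simp; ring
  rw [this, abs_div, abs_of_pos hD, div_le_div_iff₀ hD hb0]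
  have hq : C/(2*s) ≤ 1 := by rw [div_le_one (by positivity)]; exact hC1
  have hq0 : 0 ≤ C/(2*s) := by positivity
  have h3 : |(-(y^2)*cc + b*y*(C/(2*s))*ss)| ≤ y^2 + b*y := by
    refine (abs_add_le _ _).trans ?_
    rw [abs_mul, abs_mul, abs_neg, abs_of_nonneg (sq_nonneg y), abs_of_nonneg (by positivity : 0 ≤ b*y*(C/(2*s)))]
    have : b*y*(C/(2*s)) ≤ b*y := mul_le_of_le_one_right (by positivity) hq
    have := mul_le_mul this hss (abs_nonneg _) (by positivity)
    have := mul_le_mul_of_nonneg_left hcc (sq_nonneg y)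
    linarith
  have h4 : y^2 + b*y ≤ 10*b := by nlinarith
  have := mul_le_mul_of_nonneg_right (h3.trans h4) hb0.le
  nlinarith [sq_nonneg y]

/-- Existence of a good profile. -/
theorem exists_profile : ∃ B b m : ℝ, 0 < B ∧ 0 < m ∧
    (∀ y ∈ Icc (0:ℝ) (9/4), m ≤ rS B b y) ∧ 2 * rS B b (3/2) + m ≤ rS B b 2 := by
  have hcont : Continuous (fun y => (1/4) * Real.cos (Real.pi*y) + baseS y) := by
    have := baseS_cont
    fun_prop
  obtain ⟨y₀, hy₀, hmin⟩ := isCompact_Icc.exists_isMinOn (s := Icc (0:ℝ) (9/4))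
    ⟨0, by norm_num⟩ hcont.continuousOn
  set m₀ := (1/4) * Real.cos (Real.pi*y₀) + baseS y₀ with hm₀
  have hm₀pos : 0 < m₀ := baseS_pos hy₀.1 hy₀.2
  have hm1 : m₀ ≤ (1/4) * Real.cos (Real.pi*(3/2)) + baseS (3/2) := hmin (by norm_num : (3/2:ℝ) ∈ Icc (0:ℝ) (9/4))
  rw [S3_cos_three_half, baseS_three_half] at hm1
  have hpi := Real.pi_lt_d2
  have h2 : (1/4) * Real.cos (Real.pi*2) + baseS 2 ≥ 1/10 := by
    rw [baseS_formula (by norm_num) (by norm_num) (by norm_num), mul_comm, mul_comm Real.pi, Real.cos_two_pi]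
    norm_num
  set b := max 1 (60/m₀) with hb
  have hb1 : 1 ≤ b := le_max_left _ _
  have hb2 : 30/b ≤ m₀/2 := by
    have : 60/m₀ ≤ b := le_max_right _ _
    rw [div_le_iff₀ hm₀pos] at this
    rw [div_le_iff₀ (by linarith)]; linarith
  have hx : 0 < b*(Real.pi/2) := by positivity
  refine ⟨b/(8*Real.sinh (b*(Real.pi/2))), b, m₀/2, ?_, by positivity, ?_, ?_⟩
  · have := Real.sinh_pos_iff.2 hx
    positivity
  · intro y hy
    have h := (abs_le.1 (rS_close hb1 hy.1 hy.2)).1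
    have h' : m₀ ≤ (1/4) * Real.cos (Real.pi*y) + baseS y := hmin hy
    linarith
  · have h := (abs_le.1 (rS_close hb1 (y := 3/2) (by norm_num) (by norm_num))).2
    have h' := (abs_le.1 (rS_close hb1 (y := 2) (by norm_num) (by norm_num))).1
    rw [S3_cos_three_half, baseS_three_half] at h
    linarith

lemma S3_curv_alg {p q p1 q1 p2 q2 C k : ℝ} (hp : 0 < p) (hq : 0 < q) (hk : 0 ≤ k)
    (h1 : -k*p^2 ≤ C^2*(p*p2 - p1^2)) (h2 : 0 ≤ C^2*(q*q2 - q1^2)) :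
    -k*(p+q)^2 ≤ C^2*((p+q)*(p2+q2) - (p1+q1)^2) := by
  have hcross : 0 ≤ C^2*(p*q2 + q*p2 - 2*p1*q1) + k*(2*p*q) := by
    have hpq : 0 < p*q := by positivity
    have h1' : 0 ≤ (q^2)*(C^2*(p*p2 - p1^2) + k*p^2) := mul_nonneg (sq_nonneg _) (by linarith)
    have h2' : 0 ≤ p^2 * (C^2*(q*q2 - q1^2)) := mul_nonneg (sq_nonneg _) h2
    have h3 : 0 ≤ C^2*(p*q1 - q*p1)^2 := by positivity
    have h4 : 0 ≤ k*(p*q)^2 := by positivity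
    have e : (p*q)*(C^2*(p*q2 + q*p2 - 2*p1*q1) + k*(2*p*q)) =
      (q^2)*(C^2*(p*p2 - p1^2) + k*p^2) + p^2 * (C^2*(q*q2 - q1^2)) + C^2*(p*q1 - q*p1)^2
       + k*(p*q)^2 := by ring
    have h5 : 0 ≤ (p*q)*(C^2*(p*q2 + q*p2 - 2*p1*q1) + k*(2*p*q)) := by rw [e]; positivity
    exact nonneg_of_mul_nonneg_right h5 hpq
  have : 0 ≤ k*q^2 := by positivity
  have e : C^2*((p+q)*(p2+q2) - (p1+q1)^2) + k*(p+q)^2 = (C^2*(p*p2 - p1^2) + k*p^2)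
     + C^2*(q*q2 - q1^2) + (C^2*(p*q2 + q*p2 - 2*p1*q1) + k*(2*p*q)) + k*q^2 := by ring
  linarith

/-- The pointwise log-curvature bound for the profile. -/
lemma rhoS_curv {B : ℝ} (b : ℝ) (hB : 0 < B) {θ : ℝ} (hθ : 0 < Real.cos θ) :
    -(26/25) * (rhoS B b θ)^2 ≤ (Real.cos θ)^2 * (rhoS B b θ *
      (-Real.cos θ - (3/100) * Real.cos (3*θ) + B*b^2*Real.cosh (b*θ))
      - (-Real.sin θ - (1/100)*Real.sin (3*θ) + B*b*Real.sinh (b*θ))^2) := by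
  unfold rhoS
  rw [Real.cos_three_mul, Real.sin_three_mul]
  have hch : Real.cosh (b*θ)^2 = Real.sinh (b*θ)^2+1 := Real.cosh_sq _
  have hch0 : 0 < Real.cosh (b*θ) := Real.cosh_pos _
  have hsc := Real.sin_sq_add_cos_sq θ
  set C := Real.cos θ
  set S := Real.sin θ
  set q := B * Real.cosh (b*θ) with hq
  set q1 := B * b * Real.sinh (b*θ) with hq1
  have hq0 : 0 < q := by positivity
  have hq2 : B*b^2*Real.cosh (b*θ) = b^2*q := by rw [hq]; ring
  have hqq : q1^2 ≤ q*(b^2*q) := by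
    rw [hq, hq1]
    have : B^2*b^2*(Real.cosh (b*θ)^2 - Real.sinh (b*θ)^2) ≥ 0 := by rw [hch]; ring_nf; positivity
    nlinarith
  rw [hq2]
  set p := C + 1/300*(4*C^3-3*C) with hp
  set p1 := -S - 1/100*(3*S-4*S^3) with hp1
  set p2 := -C - 3/100*(4*C^3-3*C) with hp2
  have hC1 : C^2 ≤ 1 := by nlinarith [sq_nonneg S]
  have hp0 : 0 < p := by
    have : p = C*(99/100 + C^2/75) := by rw [hp]; ring
    rw [this]; positivity
  have hS : S^2 = 1 - C^2 := by linarith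
  have hpp : -(26/25)*p^2 ≤ C^2*(p*p2 - p1^2) := by
    have e1 : p1^2 = S^2*(1+1/100*(3-4*S^2))^2 := by rw [hp1]; ring
    rw [e1, hS, hp, hp2]
    set s := C^2 with hs
    have hs0 : 0 ≤ s := sq_nonneg C
    have hid : C^2*((C + 1/300*(4*C^3-3*C))*(-C - 3/100*(4*C^3-3*C)) - (1-s)*(1+1/100*(3-4*(1-s)))^2)
       + (26/25)*(C + 1/300*(4*C^3-3*C))^2
       = s*((1/25)*(99/100+s/75)^2 - s*(4*(99/100)*(1/75)*s - 2*(99/100)*(1/75) + 2*(1/75)^2*s)) := by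
      rw [hs]; ring
    have : 0 ≤ (1/25)*(99/100+s/75)^2 - s*(4*(99/100)*(1/75)*s - 2*(99/100)*(1/75) + 2*(1/75)^2*s) := by
      nlinarith [mul_nonneg hs0 (sub_nonneg.2 hC1)]
    have := mul_nonneg hs0 this
    linarith
  have hq' : 0 ≤ C^2*(q*(b^2*q) - q1^2) := mul_nonneg (sq_nonneg _) (by linarith)
  have e2 : -S - 1/100*(3*S-4*S^3) + q1 = p1 + q1 := by rw [hp1]
  have e3 : -C - 3/100*(4*C^3-3*C) + b^2*q = p2 + b^2*q := by rw [hp2]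
  rw [e2, e3]
  exact S3_curv_alg hp0 hq0 (by norm_num) hpp hq'

lemma S3_area_mv {G : ℂ → ℂ} {c : ℂ} {s : ℝ} (hs : 0 < s)
    (hG : ∀ z ∈ closedBall c s, DifferentiableAt ℂ G z) :
    ∫ z in ball c s, G z = (Real.pi * s^2 : ℝ) * G c := by
  have h1 : ∫ z in ball c s, G z = ∫ z, (ball (0:ℂ) s).indicator (fun z => G (c + z)) z := by
    rw [← integral_indicator measurableSet_ball, ← integral_add_left_eq_self _ c]
    congr 1; ext z
    simp only [indicator, mem_ball, dist_eq_norm]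
    simp
  rw [h1, ← Complex.integral_comp_polarCoord_symm]
  have hcont : ContinuousOn (fun p : ℝ × ℝ => (p.1 : ℝ) • G (circleMap c p.1 p.2))
      (Icc 0 s ×ˢ Icc (-Real.pi) Real.pi) := by
    refine ContinuousOn.smul continuous_fst.continuousOn ?_
    intro p hp
    have : ContinuousAt G (circleMap c p.1 p.2) := by
      refine (hG _ ?_).continuousAt
      rw [mem_closedBall, dist_eq_norm]; simp [circleMap]
      rw [abs_of_nonneg hp.1.1]; exact hp.1.2
    have h2 : ContinuousAt (fun p : ℝ × ℝ => circleMap c p.1 p.2) p := by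
      unfold circleMap; fun_prop
    exact (ContinuousAt.comp (f := fun p : ℝ × ℝ => circleMap c p.1 p.2) this h2).continuousWithinAt
  have hIntg : IntegrableOn (fun p : ℝ × ℝ => (p.1 : ℝ) • G (circleMap c p.1 p.2))
      (Ioo 0 s ×ˢ Ioo (-Real.pi) Real.pi) :=
    (hcont.integrableOn_compact (isCompact_Icc.prod isCompact_Icc)).mono_set
      (prod_mono Ioo_subset_Icc_self Ioo_subset_Icc_self)
  have h3 : ∫ p in polarCoord.target, p.1 •
      (ball (0:ℂ) s).indicator (fun z => G (c + z)) (Complex.polarCoord.symm p)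
      = ∫ p in Ioo 0 s ×ˢ Ioo (-Real.pi) Real.pi, (p.1 : ℝ) • G (circleMap c p.1 p.2) := by
    have hm : MeasurableSet polarCoord.target := measurableSet_Ioi.prod measurableSet_Ioo
    rw [← integral_indicator hm,
      ← integral_indicator (measurableSet_Ioo.prod measurableSet_Ioo)]
    congr 1; ext p
    simp only [indicator, polarCoord_target, mem_prod, mem_Ioi, mem_Ioo, mem_ball, dist_zero_right,
      Complex.norm_polarCoord_symm]
    have e : Complex.polarCoord.symm p + c = circleMap c p.1 p.2 := by
      rw [Complex.polarCoord_symm_apply, circleMap, Complex.exp_mul_I]; push_cast; ring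
    by_cases hp : 0 < p.1
    · rw [add_comm, e]; rw [abs_of_pos hp]
      split_ifs <;> simp_all
    · simp [hp]
  rw [h3, MeasureTheory.Measure.volume_eq_prod, setIntegral_prod _ hIntg]
  have h4 : ∀ t ∈ Ioo 0 s, ∫ θ in Ioo (-Real.pi) Real.pi, (t : ℝ) • G (circleMap c t θ)
      = ((2 * Real.pi * t : ℝ) : ℂ) * G c := by
    intro t ht
    have hd : DiffContOnCl ℂ G (ball c |t|) := by
      rw [abs_of_pos ht.1]
      apply DifferentiableOn.diffContOnCl
      rw [closure_ball _ ht.1.ne']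
      intro z hz
      exact (hG z (closedBall_subset_closedBall ht.2.le hz)).differentiableWithinAt
    have := hd.circleAverage
    rw [Real.circleAverage_def] at this
    have per : Function.Periodic (fun θ => G (circleMap c t θ)) (2*Real.pi) := by
      intro θ; simp only [periodic_circleMap c t θ]
    have h5 := per.intervalIntegral_add_eq (-Real.pi) 0
    rw [zero_add, show -Real.pi + 2*Real.pi = Real.pi by ring] at h5
    rw [integral_smul, ← integral_Ioc_eq_integral_Ioo, ← intervalIntegral.integral_of_le (by linarith [Real.pi_pos]), h5]
    rw [← this, Complex.real_smul, Complex.real_smul]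
    push_cast
    have : (Real.pi : ℂ) ≠ 0 := by exact_mod_cast Real.pi_ne_zero
    field_simp
  rw [setIntegral_congr_fun measurableSet_Ioo h4, integral_mul_const, integral_complex_ofReal,
    ← integral_Ioc_eq_integral_Ioo, ← intervalIntegral.integral_of_le hs.le]
  congr 2
  rw [intervalIntegral.integral_const_mul, integral_id]; ring

/-- Pointwise bound of a holomorphic function by its mean square over a disc. -/
lemma S3_pointwise {g : ℂ → ℂ} {c : ℂ} {s : ℝ} (hs : 0 < s)
    (hg : ∀ z ∈ closedBall c s, DifferentiableAt ℂ g z) :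
    Real.pi * s^2 * ‖g c‖^2 ≤ ∫ z in ball c s, ‖g z‖^2 := by
  have h := S3_area_mv (G := fun z => g z ^ 2) hs (fun z hz => (hg z hz).pow 2)
  have h2 := norm_integral_le_integral_norm (μ := volume.restrict (ball c s)) (fun z => g z ^ 2)
  rw [h] at h2
  simp only [norm_mul, norm_pow, Complex.norm_real, Real.norm_eq_abs] at h2
  rwa [abs_of_pos Real.pi_pos, abs_of_pos hs] at h2

lemma rhoS_cont (B b : ℝ) : Continuous (rhoS B b) := by unfold rhoS; fun_prop

lemma rhoS_even (B b θ : ℝ) : rhoS B b (-θ) = rhoS B b θ := by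
  unfold rhoS
  rw [show 3 * -θ = -(3*θ) by ring, show b * -θ = -(b*θ) by ring, Real.cos_neg, Real.cos_neg,
    Real.cosh_neg]

lemma rhoS_ge {B : ℝ} (b : ℝ) (hB : 0 < B) {θ : ℝ} (hθ : |θ| ≤ Real.pi/2) : B ≤ rhoS B b θ := by
  have hc : 0 ≤ Real.cos θ := Real.cos_nonneg_of_mem_Icc ⟨by linarith [neg_abs_le θ], by linarith [le_abs_self θ]⟩
  unfold rhoS
  rw [Real.cos_three_mul]
  have h1 : 0 ≤ Real.cos θ * (99/100 + Real.cos θ^2/75) := by positivity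
  have h2 := Real.one_le_cosh (b*θ)
  nlinarith

lemma rhoS_bdd (B b : ℝ) : ∃ M : ℝ, 1 ≤ M ∧ ∀ θ, |θ| ≤ Real.pi/2 → rhoS B b θ ≤ M := by
  obtain ⟨M, hM⟩ := (isCompact_Icc (a := -(Real.pi/2)) (b := Real.pi/2)).bddAbove_image
    (rhoS_cont B b).continuousOn
  refine ⟨max 1 M, le_max_left _ _, fun θ hθ => le_max_of_le_right (hM ⟨θ, abs_le.1 hθ, rfl⟩)⟩

/-- Truncated, Gaussian-perturbed cosine transform. -/
def rT (B b ε θ1 y : ℝ) : ℝ :=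
  ∫ θ in (-θ1)..θ1, rhoS B b θ * Real.exp (4*ε*θ^2) * Real.cos (2*y*θ)

lemma rT_ii (B b ε y c d : ℝ) : IntervalIntegrable
    (fun θ => rhoS B b θ * Real.exp (4*ε*θ^2) * Real.cos (2*y*θ)) volume c d := by
  apply Continuous.intervalIntegrable
  have := rhoS_cont B b
  fun_prop

lemma rT_even (B b ε θ1 y : ℝ) : rT B b ε θ1 (-y) = rT B b ε θ1 y := by
  unfold rT; congr 1; ext θ
  rw [show 2 * -y * θ = -(2*y*θ) by ring, Real.cos_neg]

lemma rT_wt {B b M : ℝ} (hB : 0 < B) (hM1 : 1 ≤ M) (hM : ∀ θ, |θ| ≤ Real.pi/2 → rhoS B b θ ≤ M)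
    {ε θ1 : ℝ} (hε : 0 < ε) (h1 : θ1 ≤ Real.pi/2)
    {θ : ℝ} (hθ : θ ∈ uIoc (-θ1) θ1) (h0 : 0 ≤ θ1) :
    |θ| ≤ Real.pi/2 ∧ 0 ≤ rhoS B b θ * Real.exp (4*ε*θ^2) ∧
      rhoS B b θ * Real.exp (4*ε*θ^2) ≤ M * Real.exp (ε*Real.pi^2) := by
  rw [uIoc_of_le (by linarith)] at hθ
  have ha : |θ| ≤ Real.pi/2 := abs_le.2 ⟨by linarith [hθ.1], by linarith [hθ.2]⟩
  have hr := rhoS_ge b hB ha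
  refine ⟨ha, mul_nonneg (by linarith) (Real.exp_pos _).le, ?_⟩
  have h2 : θ^2 ≤ (Real.pi/2)^2 := by
    rw [← sq_abs]; exact pow_le_pow_left₀ (abs_nonneg _) ha 2
  apply mul_le_mul (hM θ ha) _ (Real.exp_pos _).le (by linarith)
  apply Real.exp_le_exp.2; nlinarith

lemma rT_bound {B b M : ℝ} (hB : 0 < B) (hM1 : 1 ≤ M) (hM : ∀ θ, |θ| ≤ Real.pi/2 → rhoS B b θ ≤ M)
    {ε θ1 : ℝ} (hε : 0 < ε) (h0 : 0 ≤ θ1) (h1 : θ1 ≤ Real.pi/2) (y : ℝ) :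
    |rT B b ε θ1 y| ≤ Real.pi * M * Real.exp (ε*Real.pi^2) := by
  have h := intervalIntegral.norm_integral_le_of_norm_le_const (a := -θ1) (b := θ1)
    (f := fun θ => rhoS B b θ * Real.exp (4*ε*θ^2) * Real.cos (2*y*θ))
    (C := M * Real.exp (ε*Real.pi^2)) (fun θ hθ => by
      obtain ⟨_, h2, h3⟩ := rT_wt hB hM1 hM hε h1 hθ h0
      rw [norm_mul, Real.norm_of_nonneg h2]
      have := Real.abs_cos_le_one (2*y*θ)
      rw [← Real.norm_eq_abs] at this
      calc _ ≤ (M * Real.exp (ε*Real.pi^2)) * 1 := mul_le_mul h3 this (norm_nonneg _) (by positivity)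
        _ = _ := mul_one _)
  rw [Real.norm_eq_abs, abs_of_nonneg (by linarith : 0 ≤ θ1 - -θ1)] at h
  unfold rT
  have : 0 < M * Real.exp (ε*Real.pi^2) := by positivity
  nlinarith

lemma rT_lip {B b M : ℝ} (hB : 0 < B) (hM1 : 1 ≤ M) (hM : ∀ θ, |θ| ≤ Real.pi/2 → rhoS B b θ ≤ M)
    {ε θ1 : ℝ} (hε : 0 < ε) (h0 : 0 ≤ θ1) (h1 : θ1 ≤ Real.pi/2) (y y' : ℝ) :
    |rT B b ε θ1 y - rT B b ε θ1 y'| ≤ Real.pi * (Real.pi * M * Real.exp (ε*Real.pi^2)) * |y - y'| := by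
  unfold rT
  rw [← intervalIntegral.integral_sub (rT_ii _ _ _ _ _ _) (rT_ii _ _ _ _ _ _)]
  have h := intervalIntegral.norm_integral_le_of_norm_le_const (a := -θ1) (b := θ1)
    (f := fun θ => rhoS B b θ * Real.exp (4*ε*θ^2) * Real.cos (2*y*θ) -
      rhoS B b θ * Real.exp (4*ε*θ^2) * Real.cos (2*y'*θ))
    (C := M * Real.exp (ε*Real.pi^2) * (Real.pi * |y - y'|)) (fun θ hθ => by
      obtain ⟨ha, h2, h3⟩ := rT_wt hB hM1 hM hε h1 hθ h0
      rw [← mul_sub, norm_mul, Real.norm_of_nonneg h2, Real.norm_eq_abs]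
      have h5 : |Real.cos (2*y*θ) - Real.cos (2*y'*θ)| ≤ |2*y*θ - 2*y'*θ| := by
        have := Real.lipschitzWith_cos.dist_le_mul (2*y*θ) (2*y'*θ)
        simpa [Real.dist_eq] using this
      have h6 : |2*y*θ - 2*y'*θ| ≤ Real.pi * |y - y'| := by
        rw [show 2*y*θ - 2*y'*θ = 2*θ*(y-y') by ring, abs_mul, abs_mul, abs_two]
        exact mul_le_mul_of_nonneg_right (by linarith) (abs_nonneg _)
      exact mul_le_mul h3 (h5.trans h6) (abs_nonneg _) (by positivity))
  rw [Real.norm_eq_abs, abs_of_nonneg (by linarith : 0 ≤ θ1 - -θ1)] at h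
  refine h.trans ?_
  have : 0 ≤ M * Real.exp (ε*Real.pi^2) * (Real.pi * |y - y'|) := by positivity
  nlinarith

lemma rT_close {B b M : ℝ} (hB : 0 < B) (hM1 : 1 ≤ M) (hM : ∀ θ, |θ| ≤ Real.pi/2 → rhoS B b θ ≤ M)
    {ε θ1 : ℝ} (hε : 0 < ε) (h0 : 0 ≤ θ1) (h1 : θ1 ≤ Real.pi/2) (y : ℝ) :
    |rT B b ε θ1 y - rS B b y| ≤ M * (Real.pi * (Real.exp (ε*Real.pi^2) - 1) + (Real.pi - 2*θ1)) := by
  have i2 : ∀ c d, IntervalIntegrable (fun θ => rhoS B b θ * Real.cos (2*y*θ)) volume c d := by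
    intro c d
    apply Continuous.intervalIntegrable
    have := rhoS_cont B b
    fun_prop
  have hpi := Real.pi_pos
  have hsplit : rT B b ε θ1 y - rS B b y =
      (∫ θ in (-θ1)..θ1, (rhoS B b θ * Real.exp (4*ε*θ^2) * Real.cos (2*y*θ) - rhoS B b θ * Real.cos (2*y*θ)))
      - (∫ θ in (-(Real.pi/2))..(-θ1), rhoS B b θ * Real.cos (2*y*θ))
      - ∫ θ in θ1..(Real.pi/2), rhoS B b θ * Real.cos (2*y*θ) := by
    rw [intervalIntegral.integral_sub (rT_ii _ _ _ _ _ _) (i2 _ _)]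
    unfold rT rS
    rw [← intervalIntegral.integral_add_adjacent_intervals (i2 (-(Real.pi/2)) (-θ1)) (i2 (-θ1) (Real.pi/2)),
      ← intervalIntegral.integral_add_adjacent_intervals (i2 (-θ1) θ1) (i2 θ1 (Real.pi/2))]
    ring
  have hb : ∀ θ, |θ| ≤ Real.pi/2 → ‖rhoS B b θ * Real.cos (2*y*θ)‖ ≤ M := by
    intro θ ha
    have hr := rhoS_ge b hB ha
    have := Real.abs_cos_le_one (2*y*θ)
    rw [norm_mul, Real.norm_of_nonneg (by linarith), Real.norm_eq_abs]
    calc _ ≤ M * 1 := mul_le_mul (hM θ ha) this (abs_nonneg _) (by linarith)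
      _ = M := mul_one _
  have e1 := intervalIntegral.norm_integral_le_of_norm_le_const (a := -θ1) (b := θ1)
    (f := fun θ => rhoS B b θ * Real.exp (4*ε*θ^2) * Real.cos (2*y*θ) - rhoS B b θ * Real.cos (2*y*θ))
    (C := M * (Real.exp (ε*Real.pi^2) - 1)) (fun θ hθ => by
      obtain ⟨ha, h2, h3⟩ := rT_wt hB hM1 hM hε h1 hθ h0
      have he : rhoS B b θ * Real.exp (4*ε*θ^2) * Real.cos (2*y*θ) - rhoS B b θ * Real.cos (2*y*θ)
        = (rhoS B b θ * Real.cos (2*y*θ)) * (Real.exp (4*ε*θ^2) - 1) := by ring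
      rw [he, norm_mul]
      have e0 : 1 ≤ Real.exp (4*ε*θ^2) := Real.one_le_exp (by positivity)
      have h2 : θ^2 ≤ (Real.pi/2)^2 := by
        rw [← sq_abs]; exact pow_le_pow_left₀ (abs_nonneg _) ha 2
      have e3 : Real.exp (4*ε*θ^2) ≤ Real.exp (ε*Real.pi^2) := by
        apply Real.exp_le_exp.2; nlinarith
      rw [Real.norm_of_nonneg (sub_nonneg.2 e0)]
      exact mul_le_mul (hb θ ha) (by linarith) (by linarith) (by linarith))
  have e2 := intervalIntegral.norm_integral_le_of_norm_le_const (a := -(Real.pi/2)) (b := -θ1)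
    (f := fun θ => rhoS B b θ * Real.cos (2*y*θ))
    (C := M) (fun θ hθ => by
      rw [uIoc_of_le (by linarith)] at hθ
      exact hb θ (abs_le.2 ⟨by linarith [hθ.1], by linarith [hθ.2]⟩))
  have e3 := intervalIntegral.norm_integral_le_of_norm_le_const (a := θ1) (b := Real.pi/2)
    (f := fun θ => rhoS B b θ * Real.cos (2*y*θ))
    (C := M) (fun θ hθ => by
      rw [uIoc_of_le (by linarith)] at hθ
      exact hb θ (abs_le.2 ⟨by linarith [hθ.1], by linarith [hθ.2]⟩))
  rw [abs_of_nonneg (by linarith : 0 ≤ θ1 - -θ1)] at e1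
  rw [abs_of_nonneg (by linarith : 0 ≤ -θ1 - -(Real.pi/2))] at e2
  rw [abs_of_nonneg (by linarith : 0 ≤ Real.pi/2 - θ1)] at e3
  rw [hsplit, ← Real.norm_eq_abs]
  refine (norm_sub_le _ _).trans ?_
  have := norm_sub_le (∫ θ in (-θ1)..θ1, (rhoS B b θ * Real.exp (4*ε*θ^2) * Real.cos (2*y*θ) - rhoS B b θ * Real.cos (2*y*θ)))
    (∫ θ in (-(Real.pi/2))..(-θ1), rhoS B b θ * Real.cos (2*y*θ))
  have e0 : 1 ≤ Real.exp (ε*Real.pi^2) := Real.one_le_exp (by positivity)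
  have : M * (Real.exp (ε*Real.pi^2) - 1) * (θ1 - -θ1) ≤ M * (Real.exp (ε*Real.pi^2) - 1) * Real.pi :=
    mul_le_mul_of_nonneg_left (by linarith) (mul_nonneg (by linarith) (by linarith))
  linarith

/-- Combination of transforms appearing in the strip operator. -/
def ES (r : ℝ → ℝ) (ε x : ℝ) : ℝ :=
  Real.exp (2*x) * r (2-2*ε*x) + Real.exp (-2*x) * r (2+2*ε*x)
    - 2*Real.exp (3/2*x) * r (3/2-2*ε*x) - 2*Real.exp (-(3/2)*x) * r (3/2+2*ε*x)

lemma ES_lower {r : ℝ → ℝ} {C Lp m X0 ε : ℝ} (hε : 0 < ε) (hm : 0 < m) (hev : ∀ y, r (-y) = r y)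
    (hC : ∀ y, |r y| ≤ C) (hL : ∀ y y', |r y - r y'| ≤ Lp * |y - y'|) (hLp : 0 ≤ Lp) (hX0 : 0 ≤ X0)
    (hr : ∀ y ∈ Icc (0:ℝ) (9/4), m ≤ r y) (hk : 2 * r (3/2) + m ≤ r 2)
    (hX : 5*C/m ≤ Real.exp (X0/2)) (hεX : 6*Lp*ε*X0 ≤ m) (x : ℝ) :
    -(3*C*Real.exp (-(17/(128*ε))) * Real.exp (-(|x|/16))) ≤ (1/2)*Real.exp (-ε*x^2) * ES r ε x := by
  have hC0 : 0 < C := lt_of_lt_of_le hm ((hr 0 (by norm_num)).trans ((le_abs_self _).trans (hC 0)))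
  wlog hx : 0 ≤ x generalizing x with H
  · have := H (-x) (by linarith)
    rw [abs_neg] at this
    have e : ES r ε (-x) = ES r ε x := by
      unfold ES
      rw [show 2 * -x = -2*x by ring, show 2 - 2*ε*(-x) = 2+2*ε*x by ring,
        show -2 * -x = 2*x by ring, show 2 + 2*ε*(-x) = 2-2*ε*x by ring,
        show 3/2 * -x = -(3/2)*x by ring, show -(3/2) * -x = 3/2*x by ring,
        show 3/2 - 2*ε*(-x) = 3/2+2*ε*x by ring, show 3/2 + 2*ε*(-x) = 3/2-2*ε*x by ring]
      ring
    rw [e, neg_sq] at this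
    exact this
  have hneg : -(3*C*Real.exp (-(17/(128*ε))) * Real.exp (-(|x|/16))) ≤ 0 := by
    rw [neg_nonpos]; positivity
  have hr' : ∀ y, |y| ≤ 9/4 → m ≤ r y := by
    intro y hy
    rcases abs_cases y with ⟨h, h'⟩ | ⟨h, h'⟩
    · exact hr y ⟨h', by linarith⟩
    · rw [← hev]; exact hr _ ⟨by linarith, by linarith⟩
  by_cases h1 : x ≤ X0
  · refine hneg.trans (mul_nonneg (by positivity) ?_)
    have hd : ∀ y : ℝ, |r (y - 2*ε*x) - r y| ≤ 2*Lp*ε*X0 ∧ |r (y + 2*ε*x) - r y| ≤ 2*Lp*ε*X0 := by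
      intro y
      have hx2 : Lp * (2*ε*x) ≤ 2*Lp*ε*X0 := by nlinarith [mul_nonneg hLp hε.le]
      constructor
      · refine (hL _ _).trans ?_
        rw [show y - 2*ε*x - y = -(2*ε*x) by ring, abs_neg, abs_of_nonneg (by positivity)]; exact hx2
      · refine (hL _ _).trans ?_
        rw [show y + 2*ε*x - y = (2*ε*x) by ring, abs_of_nonneg (by positivity)]; exact hx2
    obtain ⟨a1, a2⟩ := hd 2
    obtain ⟨a3, a4⟩ := hd (3/2)
    rw [abs_le] at a1 a2 a3 a4
    set δ := 2*Lp*ε*X0 with hδ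
    have h3δ : 3*δ ≤ m := by rw [hδ]; linarith
    have hr32 := hr (3/2) (by norm_num)
    have hcosh : Real.exp (3/2*x) + Real.exp (-(3/2)*x) ≤ Real.exp (2*x) + Real.exp (-2*x) := by
      have := Real.cosh_le_cosh.2 (show |3/2*x| ≤ |2*x| by
        rw [abs_of_nonneg (by positivity), abs_of_nonneg (by positivity)]; linarith)
      rw [Real.cosh_eq, Real.cosh_eq] at this
      rw [show -(3/2)*x = -(3/2*x) by ring, show -2*x = -(2*x) by ring]
      linarith
    unfold ES
    have p1 := Real.exp_pos (2*x)
    have p2 := Real.exp_pos (-2*x)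
    have p3 := Real.exp_pos (3/2*x)
    have p4 := Real.exp_pos (-(3/2)*x)
    have b1 : Real.exp (2*x) * (r 2 - δ) ≤ Real.exp (2*x) * r (2-2*ε*x) := mul_le_mul_of_nonneg_left (by linarith) p1.le
    have b2 : Real.exp (-2*x) * (r 2 - δ) ≤ Real.exp (-2*x) * r (2+2*ε*x) := mul_le_mul_of_nonneg_left (by linarith) p2.le
    have b3 : Real.exp (3/2*x) * r (3/2-2*ε*x) ≤ Real.exp (3/2*x) * (r (3/2) + δ) := mul_le_mul_of_nonneg_left (by linarith) p3.le
    have b4 : Real.exp (-(3/2)*x) * r (3/2+2*ε*x) ≤ Real.exp (-(3/2)*x) * (r (3/2) + δ) := mul_le_mul_of_nonneg_left (by linarith) p4.le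
    have b5 : (Real.exp (3/2*x) + Real.exp (-(3/2)*x)) * (r 2 - δ) ≤ (Real.exp (2*x) + Real.exp (-2*x)) * (r 2 - δ) :=
      mul_le_mul_of_nonneg_right hcosh (by linarith)
    have b6 : 0 ≤ (Real.exp (3/2*x) + Real.exp (-(3/2)*x)) * (r 2 - δ - 2*(r (3/2) + δ)) :=
      mul_nonneg (by positivity) (by linarith)
    linarith
  push Not at h1
  have q1 : Real.exp (-2*x) ≤ Real.exp (3/2*x) := Real.exp_le_exp.2 (by linarith)
  have q2 : Real.exp (-(3/2)*x) ≤ Real.exp (3/2*x) := Real.exp_le_exp.2 (by linarith)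
  have hc := fun y => abs_le.1 (hC y)
  have c2 : -(Real.exp (3/2*x) * C) ≤ Real.exp (-2*x) * r (2+2*ε*x) := by
    have := mul_le_mul q1 (hC (2+2*ε*x)) (abs_nonneg _) (Real.exp_pos _).le
    have h2 := neg_abs_le (Real.exp (-2*x) * r (2+2*ε*x))
    rw [abs_mul, abs_of_pos (Real.exp_pos _)] at h2; linarith
  have c3 : Real.exp (3/2*x) * r (3/2-2*ε*x) ≤ Real.exp (3/2*x) * C := 
    mul_le_mul_of_nonneg_left (hc _).2 (Real.exp_pos _).le
  have c4 : Real.exp (-(3/2)*x) * r (3/2+2*ε*x) ≤ Real.exp (3/2*x) * C := by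
    have := mul_le_mul q2 (hC (3/2+2*ε*x)) (abs_nonneg _) (Real.exp_pos _).le
    have h2 := le_abs_self (Real.exp (-(3/2)*x) * r (3/2+2*ε*x))
    rw [abs_mul, abs_of_pos (Real.exp_pos _)] at h2; linarith
  by_cases h2 : 2*ε*x ≤ 17/4
  · refine hneg.trans (mul_nonneg (by positivity) ?_)
    have hm2 : m ≤ r (2-2*ε*x) := hr' _ (abs_le.2 ⟨by linarith, by nlinarith⟩)
    have c1 : Real.exp (2*x) * m ≤ Real.exp (2*x) * r (2-2*ε*x) := mul_le_mul_of_nonneg_left hm2 (Real.exp_pos _).le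
    have c5 : 5*C ≤ Real.exp (x/2) * m := by
      rw [div_le_iff₀ hm] at hX
      exact hX.trans (mul_le_mul_of_nonneg_right (Real.exp_le_exp.2 (by linarith)) hm.le)
    have c6 : Real.exp (2*x) = Real.exp (3/2*x) * Real.exp (x/2) := by rw [← Real.exp_add]; ring_nf
    have c7 : Real.exp (3/2*x) * (5*C) ≤ Real.exp (3/2*x) * (Real.exp (x/2) * m) :=
      mul_le_mul_of_nonneg_left c5 (Real.exp_pos _).le
    unfold ES
    rw [c6] at c1 ⊢
    linarith
  · push Not at h2
    have q3 : Real.exp (3/2*x) ≤ Real.exp (2*x) := Real.exp_le_exp.2 (by linarith)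
    have c1 : -(Real.exp (2*x) * C) ≤ Real.exp (2*x) * r (2-2*ε*x) := by
      have := mul_le_mul_of_nonneg_left (hc (2-2*ε*x)).1 (Real.exp_pos (2*x)).le
      linarith
    have c5 : Real.exp (3/2*x) * C ≤ Real.exp (2*x) * C := mul_le_mul_of_nonneg_right q3 hC0.le
    have hE : -(6 * C * Real.exp (2*x)) ≤ ES r ε x := by unfold ES; linarith
    have hfin : Real.exp (-ε*x^2) * Real.exp (2*x) ≤ Real.exp (-(17/(128*ε))) * Real.exp (-(|x|/16)) := by
      rw [← Real.exp_add, ← Real.exp_add, abs_of_nonneg hx]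
      apply Real.exp_le_exp.2
      have : 17/(128*ε) ≤ x/16 := by
        rw [div_le_iff₀ (by positivity)]; nlinarith
      nlinarith
    have hh := mul_le_mul_of_nonneg_left hE (Real.exp_pos (-ε*x^2)).le
    have := mul_le_mul_of_nonneg_left hfin (by positivity : (0:ℝ) ≤ 3*C)
    linarith

/-- The entire test function. -/
def fS (ε : ℝ) (u : ℂ) : ℂ :=
  (1/2) * (Complex.exp (2*u - ε*u^2) + Complex.exp (-2*u - ε*u^2))
    - (Complex.exp (3/2*u - ε*u^2) + Complex.exp (-(3/2)*u - ε*u^2))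

lemma fS_diff (ε : ℝ) : Differentiable ℂ (fS ε) := by unfold fS; fun_prop

lemma fS_zero (ε : ℝ) : fS ε 0 = -1 := by unfold fS; simp; norm_num

lemma S3_exp_re (k : ℝ) (ε x θ : ℝ) :
    (Complex.exp ((k:ℂ)*((x:ℂ) + 2*θ*I) - ε*((x:ℂ) + 2*θ*I)^2)).re
      = Real.exp (-ε*x^2) * Real.exp (4*ε*θ^2) * (Real.exp (k*x) * Real.cos (2*(k - 2*ε*x)*θ)) := by
  rw [Complex.exp_re]
  have e1 : ((k:ℂ)*((x:ℂ) + 2*θ*I) - ε*((x:ℂ) + 2*θ*I)^2).re = -ε*x^2 + 4*ε*θ^2 + k*x := by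
    simp [pow_two]; ring
  have e2 : ((k:ℂ)*((x:ℂ) + 2*θ*I) - ε*((x:ℂ) + 2*θ*I)^2).im = 2*(k - 2*ε*x)*θ := by
    simp [pow_two]; ring
  rw [e1, e2, Real.exp_add, Real.exp_add]; ring

lemma fS_re (ε x θ : ℝ) : (fS ε ((x:ℂ) + 2*θ*I)).re =
    (1/2) * Real.exp (-ε*x^2) * (Real.exp (4*ε*θ^2) *
      (Real.exp (2*x) * Real.cos (2*(2-2*ε*x)*θ) + Real.exp (-2*x) * Real.cos (2*(2+2*ε*x)*θ)
       - 2*Real.exp (3/2*x) * Real.cos (2*(3/2-2*ε*x)*θ)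
       - 2*Real.exp (-(3/2)*x) * Real.cos (2*(3/2+2*ε*x)*θ))) := by
  have a1 := S3_exp_re 2 ε x θ
  have a2 := S3_exp_re (-2) ε x θ
  have a3 := S3_exp_re (3/2) ε x θ
  have a4 := S3_exp_re (-(3/2)) ε x θ
  push_cast at a1 a2 a3 a4
  have e : ∀ w v : ℂ, ((1/2) * w - v).re = (1/2) * w.re - v.re := by intro w v; simp
  unfold fS
  rw [e, Complex.add_re, Complex.add_re, a1, a2, a3, a4]
  rw [show 2*(-2 - 2*ε*x)*θ = -(2*(2+2*ε*x)*θ) by ring, Real.cos_neg,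
    show 2*(-(3/2) - 2*ε*x)*θ = -(2*(3/2+2*ε*x)*θ) by ring, Real.cos_neg]
  ring

lemma fS_transform (B b ε θ1 x : ℝ) :
    ∫ θ in (-θ1)..θ1, rhoS B b θ * (fS ε ((x:ℂ) + 2*θ*I)).re
      = (1/2) * Real.exp (-ε*x^2) * ES (rT B b ε θ1) ε x := by
  have : ∀ θ : ℝ, rhoS B b θ * (fS ε ((x:ℂ) + 2*θ*I)).re = (1/2) * Real.exp (-ε*x^2) *
      (Real.exp (2*x) * (rhoS B b θ * Real.exp (4*ε*θ^2) * Real.cos (2*(2-2*ε*x)*θ))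
      + Real.exp (-2*x) * (rhoS B b θ * Real.exp (4*ε*θ^2) * Real.cos (2*(2+2*ε*x)*θ))
      - 2*Real.exp (3/2*x) * (rhoS B b θ * Real.exp (4*ε*θ^2) * Real.cos (2*(3/2-2*ε*x)*θ))
      - 2*Real.exp (-(3/2)*x) * (rhoS B b θ * Real.exp (4*ε*θ^2) * Real.cos (2*(3/2+2*ε*x)*θ))) := by
    intro θ; rw [fS_re]; ring
  simp only [this]
  have i := fun (k y : ℝ) => (rT_ii B b ε y (-θ1) θ1).const_mul k
  rw [intervalIntegral.integral_const_mul, intervalIntegral.integral_sub (((i _ _).add (i _ _)).sub (i _ _)) (i _ _),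
    intervalIntegral.integral_sub ((i _ _).add (i _ _)) (i _ _), intervalIntegral.integral_add (i _ _) (i _ _),
    intervalIntegral.integral_const_mul, intervalIntegral.integral_const_mul,
    intervalIntegral.integral_const_mul, intervalIntegral.integral_const_mul]
  rfl

/-- Decay constant. -/
def KS (ε : ℝ) : ℝ := 3 * Real.exp (ε*(2*Real.pi)^2 + 9/(4*ε))

lemma KS_pos (ε : ℝ) : 0 < KS ε := by unfold KS; positivity

lemma fS_bound {ε : ℝ} (hε : 0 < ε) {u : ℂ} (hu : |u.im| ≤ 2*Real.pi) :
    ‖fS ε u‖ ≤ KS ε * Real.exp (-|u.re|) := by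
  have key : ∀ k : ℝ, |k| ≤ 2 → ‖Complex.exp ((k:ℂ)*u - ε*u^2)‖
      ≤ Real.exp (ε*(2*Real.pi)^2 + 9/(4*ε)) * Real.exp (-|u.re|) := by
    intro k hk
    rw [Complex.norm_exp, ← Real.exp_add]
    apply Real.exp_le_exp.2
    have : ((k:ℂ)*u - ε*u^2).re = k*u.re - ε*(u.re^2 - u.im^2) := by simp [pow_two]
    rw [this]
    have h1 : k*u.re ≤ 2*|u.re| := by
      refine (le_abs_self _).trans ?_
      rw [abs_mul]; exact mul_le_mul_of_nonneg_right hk (abs_nonneg _)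
    have h2 : u.im^2 ≤ (2*Real.pi)^2 := by rw [← sq_abs]; exact pow_le_pow_left₀ (abs_nonneg _) hu 2
    have h3 : 3*|u.re| - ε*u.re^2 ≤ 9/(4*ε) := by
      rw [le_div_iff₀ (by positivity), ← sq_abs u.re]
      nlinarith [sq_nonneg (2*ε*|u.re| - 3)]
    nlinarith
  have k1 := key 2 (by norm_num)
  have k2 := key (-2) (by norm_num)
  have k3 := key (3/2) (by rw [abs_of_pos] <;> norm_num)
  have k4 := key (-(3/2)) (by rw [abs_neg, abs_of_pos] <;> norm_num)
  push_cast at k1 k2 k3 k4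
  unfold fS KS
  refine (norm_sub_le _ _).trans ?_
  have n1 := norm_add_le (Complex.exp (2*u - ε*u^2)) (Complex.exp (-2*u - ε*u^2))
  have n2 := norm_add_le (Complex.exp (3/2*u - ε*u^2)) (Complex.exp (-(3/2)*u - ε*u^2))
  rw [norm_mul]
  have : ‖(1/2 : ℂ)‖ = 1/2 := by norm_num
  rw [this]
  linarith

/-- The strip. -/
def stripS : Set ℂ := {u | |u.im| < Real.pi/2}

lemma stripS_open : IsOpen stripS := isOpen_lt (by fun_prop) continuous_const

lemma S3_exp_le (x : ℝ) : Real.exp (-(2*|x|)) ≤ (1+x^2)⁻¹ := by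
  rw [Real.exp_neg]
  apply inv_anti₀ (by positivity)
  have := Real.quadratic_le_exp_of_nonneg (by positivity : 0 ≤ 2*|x|)
  have h := sq_abs x
  nlinarith [abs_nonneg x]

lemma S3_exp_le16 (x : ℝ) : Real.exp (-(|x|/16)) ≤ 512 * (1+x^2)⁻¹ := by
  rw [Real.exp_neg, ← div_eq_mul_inv, inv_le_iff_one_le_mul₀ (Real.exp_pos _)]
  rw [div_mul_eq_mul_div, le_div_iff₀ (by positivity)]
  have := Real.quadratic_le_exp_of_nonneg (by positivity : 0 ≤ |x|/16)
  have h := sq_abs x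
  nlinarith [abs_nonneg x]

lemma S3_strip_int : IntegrableOn (fun u : ℂ => (1+u.re^2)⁻¹) stripS := by
  have h1 : Integrable (fun p : ℝ × ℝ => (1+p.1^2)⁻¹ * (Ioo (-(Real.pi/2)) (Real.pi/2)).indicator (fun _ => (1:ℝ)) p.2)
      (volume.prod volume) := by
    apply Integrable.mul_prod integrable_inv_one_add_sq
    exact (integrable_indicator_iff measurableSet_Ioo).2 (integrableOn_const (by simp))
  rw [← integrable_indicator_iff stripS_open.measurableSet]
  have h2 := (Complex.volume_preserving_equiv_real_prod.integrable_comp_emb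
    Complex.measurableEquivRealProd.measurableEmbedding).2 h1
  refine h2.congr (Filter.Eventually.of_forall fun u => ?_)
  simp only [indicator, stripS, mem_setOf_eq, Function.comp, Complex.measurableEquivRealProd_apply, mem_Ioo, abs_lt]
  split_ifs <;> simp

lemma fS_sq_int {B b : ℝ} (hB : 0 < B) {ε : ℝ} (hε : 0 < ε) :
    IntegrableOn (fun u : ℂ => ‖fS ε u‖^2 * rhoS B b u.im) stripS := by
  obtain ⟨M, hM1, hM⟩ := rhoS_bdd B b
  refine Integrable.mono' (S3_strip_int.const_mul ((KS ε)^2 * M)) ?_ ?_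
  · apply Continuous.aestronglyMeasurable
    have := (fS_diff ε).continuous
    have := rhoS_cont B b
    fun_prop
  · rw [ae_restrict_iff' stripS_open.measurableSet]
    refine Filter.Eventually.of_forall fun u hu => ?_
    have hu' : |u.im| ≤ Real.pi/2 := le_of_lt hu
    have hr := rhoS_ge b hB hu'
    have hf := fS_bound hε (u := u) (by linarith [Real.pi_pos])
    rw [Real.norm_of_nonneg (mul_nonneg (by positivity) (by linarith))]
    have h2 : ‖fS ε u‖^2 ≤ (KS ε)^2 * (1+u.re^2)⁻¹ := by
      calc _ ≤ (KS ε * Real.exp (-|u.re|))^2 := pow_le_pow_left₀ (norm_nonneg _) hf 2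
        _ = (KS ε)^2 * Real.exp (-(2*|u.re|)) := by rw [mul_pow, ← Real.exp_nat_mul]; ring_nf
        _ ≤ _ := mul_le_mul_of_nonneg_left (S3_exp_le _) (by positivity)
    calc _ ≤ ((KS ε)^2 * (1+u.re^2)⁻¹) * M := mul_le_mul h2 (hM _ hu') (by linarith) (by positivity)
      _ = _ := by ring

/-- Rectangles exhausting the strip. -/
def rectS (L t : ℝ) : Set ℂ := {u | |u.re| ≤ L ∧ |u.im| ≤ t}

lemma rectS_meas (L t : ℝ) : MeasurableSet (rectS L t) :=
  (measurableSet_le (f := fun u : ℂ => |u.re|) (by fun_prop) measurable_const).inter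
    (measurableSet_le (f := fun u : ℂ => |u.im|) (by fun_prop) measurable_const)

lemma fS_tail {B b : ℝ} (hB : 0 < B) {ε : ℝ} (hε : 0 < ε) :
    Filter.Tendsto (fun n : ℕ => ∫ u in stripS \ rectS (n+1) (Real.pi/2 - 2/(n+1)), ‖fS ε u‖^2 * rhoS B b u.im)
      Filter.atTop (nhds 0) := by
  have h := tendsto_setIntegral_of_antitone (μ := volume) (f := fun u : ℂ => ‖fS ε u‖^2 * rhoS B b u.im)
    (s := fun n : ℕ => stripS \ rectS (n+1) (Real.pi/2 - 2/(n+1)))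
    (fun n => stripS_open.measurableSet.diff (rectS_meas _ _)) ?_ ⟨0, (fS_sq_int hB hε).mono_set sdiff_subset⟩
  · have e : (⋂ n : ℕ, stripS \ rectS (n+1) (Real.pi/2 - 2/(n+1))) = ∅ := by
      apply eq_empty_of_forall_notMem
      intro u hu
      simp only [mem_iInter, mem_sdiff] at hu
      have hs := (hu 0).1
      obtain ⟨k, hk⟩ := exists_nat_gt |u.re|
      obtain ⟨l, hl⟩ := exists_nat_gt (2/(Real.pi/2 - |u.im|))
      have hpos : 0 < Real.pi/2 - |u.im| := by have : |u.im| < Real.pi/2 := hs; linarith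
      refine (hu (k+l)).2 ⟨?_, ?_⟩
      · push_cast; have : (0:ℝ) ≤ l := l.cast_nonneg; linarith
      · rw [div_lt_iff₀ hpos] at hl
        have h3 : 2/((↑(k+l):ℝ)+1) ≤ Real.pi/2 - |u.im| := by
          rw [div_le_iff₀ (by positivity)]
          push_cast
          have : (0:ℝ) ≤ k := k.cast_nonneg
          nlinarith
        linarith
    rw [e] at h
    simpa using h
  · intro i j hij u hu
    refine ⟨hu.1, fun h => hu.2 ⟨h.1.trans ?_, h.2.trans ?_⟩⟩
    · have : (i:ℝ) ≤ j := by exact_mod_cast hij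
      linarith
    · have : (i:ℝ) ≤ j := by exact_mod_cast hij
      have : 2/((j:ℝ)+1) ≤ 2/((i:ℝ)+1) := by gcongr
      linarith

lemma S3_contour {h : ℂ → ℂ} {L θ D : ℝ} (hL : 0 < L) 
    (hh : DifferentiableOn ℂ h (rectS L |θ|))
    (hb : ∀ y : ℝ, |y| ≤ |θ| → ‖h (L + y*I)‖ ≤ D ∧ ‖h (-L + y*I)‖ ≤ D) :
    ‖(∫ x in (-L)..L, h (x - θ*I)) - ∫ x in (-L)..L, h x‖ ≤ 2 * |θ| * D := by
  have H := Complex.integral_boundary_rect_eq_zero_of_differentiableOn h ⟨-L, -θ⟩ ⟨L, 0⟩ (by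
    refine hh.mono ?_
    intro u hu
    rw [Complex.mem_reProdIm] at hu
    obtain ⟨h1, h2⟩ := hu
    simp only at h1 h2
    rw [uIcc_of_le (by linarith)] at h1
    refine ⟨abs_le.2 h1, ?_⟩
    have := abs_sub_right_of_mem_uIcc h2
    simpa using this)
  simp only [Complex.ofReal_neg, Complex.ofReal_zero, zero_mul, add_zero, neg_mul, ← sub_eq_add_neg] at H
  have e : (∫ x in (-L)..L, h (x - θ*I)) - ∫ x in (-L)..L, h x =
    I • (∫ y in (-θ)..0, h (-L + y*I)) - I • (∫ y in (-θ)..0, h (L + y*I)) := by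
    linear_combination H
  rw [e]
  refine (norm_sub_le _ _).trans ?_
  rw [norm_smul, norm_smul, Complex.norm_I, one_mul, one_mul]
  have hy : ∀ y ∈ uIoc (-θ) 0, |y| ≤ |θ| := by
    intro y hy
    have := abs_sub_right_of_mem_uIcc (uIoc_subset_uIcc hy)
    simpa using this
  have b1 := intervalIntegral.norm_integral_le_of_norm_le_const (a := -θ) (b := 0) (f := fun y : ℝ => h (-L + y*I))
    (fun y hy' => (hb y (hy y hy')).2)
  have b2 := intervalIntegral.norm_integral_le_of_norm_le_const (a := -θ) (b := 0) (f := fun y : ℝ => h (L + y*I))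
    (fun y hy' => (hb y (hy y hy')).1)
  rw [show |0 - -θ| = |θ| by simp] at b1 b2
  linarith

lemma S3_rect_integral (F : ℂ → ℝ) (L t : ℝ) :
    ∫ u in rectS L t, F u = ∫ p in Icc (-L) L ×ˢ Icc (-t) t, F ((p.1:ℂ) + p.2*I) := by
  have := Complex.volume_preserving_equiv_real_prod.symm.setIntegral_preimage_emb
    Complex.measurableEquivRealProd.symm.measurableEmbedding F (rectS L t)
  rw [← this]
  have e : (Complex.measurableEquivRealProd.symm ⁻¹' rectS L t) = Icc (-L) L ×ˢ Icc (-t) t := by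
    ext p
    simp only [mem_prod, mem_Icc, ← abs_le]
    simp [rectS, Complex.measurableEquivRealProd]
  rw [e]
  congr 1
  ext p
  congr 1
  apply Complex.ext <;> simp [Complex.measurableEquivRealProd]

/-- The pointwise bound used in the strip. -/
lemma S3_ptw {B b : ℝ} (hB : 0 < B) {Ω : Set ℂ} {g : ℂ → ℂ} (hΩ : IsOpen Ω) (hΩS : Ω ⊆ stripS)
    (hg : DifferentiableOn ℂ g Ω) (hgi : IntegrableOn (fun u => ‖g u‖^2 * rhoS B b u.im) Ω)
    {c : ℂ} {s : ℝ} (hs : 0 < s) (hc : closedBall c s ⊆ Ω) :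
    ‖g c‖ * s ≤ Real.sqrt (∫ u in Ω, ‖g u‖^2 * rhoS B b u.im) / Real.sqrt (Real.pi * B) := by
  rw [← Real.sqrt_div' _ (by positivity)]
  apply Real.le_sqrt_of_sq_le
  rw [le_div_iff₀ (by positivity)]
  have h1 := S3_pointwise hs (fun z hz => (hg z (hc hz)).differentiableAt (hΩ.mem_nhds (hc hz)))
  have hcont : ContinuousOn (fun u => ‖g u‖^2) (closedBall c s) := (hg.continuousOn.mono hc).norm.pow 2
  have hi1 : IntegrableOn (fun u => ‖g u‖^2) (ball c s) :=
    (hcont.integrableOn_compact (isCompact_closedBall c s)).mono_set ball_subset_closedBall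
  have hsub : ball c s ⊆ Ω := ball_subset_closedBall.trans hc
  have h2 : B * ∫ z in ball c s, ‖g z‖^2 ≤ ∫ z in ball c s, ‖g z‖^2 * rhoS B b z.im := by
    rw [← integral_const_mul]
    apply setIntegral_mono_on (hi1.const_mul B) (hgi.mono_set hsub) measurableSet_ball
    intro u hu
    have := rhoS_ge b hB (le_of_lt (hΩS (hsub hu)) : |u.im| ≤ Real.pi/2)
    nlinarith [sq_nonneg ‖g u‖]
  have h3 : ∫ z in ball c s, ‖g z‖^2 * rhoS B b z.im ≤ ∫ z in Ω, ‖g z‖^2 * rhoS B b z.im := by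
    apply setIntegral_mono_set hgi _ hsub.eventuallyLE
    rw [Filter.EventuallyLE, ae_restrict_iff' hΩ.measurableSet]
    refine Filter.Eventually.of_forall fun u hu => ?_
    have := rhoS_ge b hB (le_of_lt (hΩS hu) : |u.im| ≤ Real.pi/2)
    exact mul_nonneg (by positivity) (by linarith)
  nlinarith [mul_le_mul_of_nonneg_left h1 hB.le]

lemma S3_rect_integrable {Φ : ℝ → ℝ → ℝ} {L t : ℝ}
    (h : ContinuousOn (Function.uncurry Φ) (Icc (-L) L ×ˢ Icc (-t) t)) :
    Integrable (Function.uncurry Φ)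
      (((volume : Measure ℝ).restrict (Icc (-L) L)).prod ((volume : Measure ℝ).restrict (Icc (-t) t))) := by
  rw [Measure.prod_restrict]
  exact h.integrableOn_compact (isCompact_Icc.prod isCompact_Icc)

lemma S3_rect_lower {B b M : ℝ} (hB : 0 < B) (hM1 : 1 ≤ M) (hM : ∀ θ, |θ| ≤ Real.pi/2 → rhoS B b θ ≤ M)
    {ε L A : ℝ} (hε : 0 < ε) (hL : 2 ≤ L) (hA : 0 ≤ A)
    (hT : ∀ x, -(A * Real.exp (-(|x|/16))) ≤
      (1/2)*Real.exp (-ε*x^2) * ES (rT B b ε (Real.pi/2 - 2/L)) ε x)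
    {Ω : Set ℂ} {g : ℂ → ℂ} (hΩ : IsOpen Ω) (hΩS : Ω ⊆ stripS)
    (hQ : rectS (L+1) (Real.pi/2 - 1/L) ⊆ Ω)
    (hg : DifferentiableOn ℂ g Ω) (hgi : IntegrableOn (fun u => ‖g u‖^2 * rhoS B b u.im) Ω)
    (hsym : ∀ u ∈ rectS (L+1) (Real.pi/2 - 1/L), (starRingEnd ℂ) (g u) = g ((starRingEnd ℂ) u))
    (hpos : ∀ x : ℝ, |x| ≤ L → 0 ≤ (g x).re)
    {N : ℝ} (hN : N = Real.sqrt (∫ u in Ω, ‖g u‖^2 * rhoS B b u.im) / Real.sqrt (Real.pi * B)) :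
    -(A * 512 * Real.pi * (2*N)) - Real.pi * M * (Real.pi * (KS ε * Real.exp (-L) * (L*N))) ≤
      ∫ u in rectS L (Real.pi/2 - 2/L), (fS ε u * (starRingEnd ℂ) (g u) * (rhoS B b u.im : ℂ)).re := by
  have hpi := Real.pi_gt_three
  have hN0 : 0 ≤ N := by rw [hN]; positivity
  have hL1 : 1/L ≤ 1/2 := by rw [div_le_div_iff₀ (by linarith) (by norm_num)]; linarith
  have hL2 : 2/L = 1/L + 1/L := by ring
  have hL0 : 0 < 1/L := by positivity
  have h2L : 0 < 2/L := by positivity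
  set t := Real.pi/2 - 2/L with ht
  have ht0 : 0 ≤ t := by rw [ht]; linarith
  have htpi : t ≤ Real.pi/2 := by rw [ht]; linarith
  set D := KS ε * Real.exp (-L) * (L*N) with hD
  have hD0 : 0 ≤ D := by rw [hD]; have := KS_pos ε; positivity
  have hsmall : ∀ u : ℂ, |u.re| ≤ L → |u.im| ≤ t → u ∈ rectS (L+1) (Real.pi/2 - 1/L) :=
    fun u h1 h2 => ⟨by linarith, by linarith⟩
  have hptw : ∀ c : ℂ, |c.re| ≤ L → ∀ s : ℝ, 0 < s → s ≤ 1 → |c.im| + s ≤ Real.pi/2 - 1/L → ‖g c‖ * s ≤ N := by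
    intro c hc s hs hs1 hc2
    rw [hN]
    apply S3_ptw hB hΩ hΩS hg hgi hs
    refine Subset.trans ?_ hQ
    intro u hu
    rw [mem_closedBall, dist_eq_norm] at hu
    have h1 := (Complex.abs_re_le_norm (u - c)).trans hu
    have h2 := (Complex.abs_im_le_norm (u - c)).trans hu
    rw [Complex.sub_re] at h1
    rw [Complex.sub_im] at h2
    have h3 := abs_sub_abs_le_abs_sub u.re c.re
    have h4 := abs_sub_abs_le_abs_sub u.im c.im
    exact ⟨by linarith, by linarith⟩
  have hgc : ContinuousOn g Ω := hg.continuousOn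
  have hfc := (fS_diff ε).continuous
  have hrc := rhoS_cont B b
  -- reality on the axis
  have him : ∀ x : ℝ, |x| ≤ L → (g x).im = 0 := by
    intro x hx
    have := hsym x (hsmall x (by simpa using hx) (by simpa using ht0))
    rw [Complex.conj_ofReal] at this
    exact Complex.conj_eq_iff_im.1 this
  -- the two integrands
  set Φ : ℝ → ℝ → ℝ := fun x θ => rhoS B b θ * (fS ε ((x - θ*I) + 2*θ*I) * g (x - θ*I)).re with hΦ
  set Ψ : ℝ → ℝ → ℝ := fun x θ => rhoS B b θ * (fS ε (x + 2*θ*I) * g x).re with hΨ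
  have cΦ : ContinuousOn (Function.uncurry Φ) (Icc (-L) L ×ˢ Icc (-t) t) := by
    have : ContinuousOn (fun p : ℝ × ℝ => g ((p.1:ℂ) - p.2*I)) (Icc (-L) L ×ˢ Icc (-t) t) := by
      refine hgc.comp (by fun_prop) ?_
      intro p hp
      exact hQ (hsmall _ (by simpa using abs_le.2 hp.1) (by simpa using abs_le.2 hp.2))
    have h2 : Continuous (fun p : ℝ × ℝ => fS ε ((p.1 - p.2*I) + 2*p.2*I)) := by fun_prop
    have h3 : ContinuousOn (fun p : ℝ × ℝ => rhoS B b p.2) (Icc (-L) L ×ˢ Icc (-t) t) := by fun_prop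
    exact h3.mul (Complex.continuous_re.comp_continuousOn (h2.continuousOn.mul this))
  have cΨ : ContinuousOn (Function.uncurry Ψ) (Icc (-L) L ×ˢ Icc (-t) t) := by
    have : ContinuousOn (fun p : ℝ × ℝ => g (p.1:ℂ)) (Icc (-L) L ×ˢ Icc (-t) t) := by
      refine hgc.comp (by fun_prop) ?_
      intro p hp
      exact hQ (hsmall _ (by simpa using abs_le.2 hp.1) (by simpa using ht0))
    have h2 : Continuous (fun p : ℝ × ℝ => fS ε (p.1 + 2*p.2*I)) := by fun_prop
    have h3 : ContinuousOn (fun p : ℝ × ℝ => rhoS B b p.2) (Icc (-L) L ×ˢ Icc (-t) t) := by fun_prop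
    exact h3.mul (Complex.continuous_re.comp_continuousOn (h2.continuousOn.mul this))
  have iΦ := S3_rect_integrable cΦ
  have iΨ := S3_rect_integrable cΨ
  -- rewrite the area integral
  have e1 : ∫ u in rectS L t, (fS ε u * (starRingEnd ℂ) (g u) * (rhoS B b u.im : ℂ)).re
      = ∫ θ in Icc (-t) t, ∫ x in Icc (-L) L, Φ x θ := by
    rw [← integral_integral_swap iΦ, integral_integral iΦ, Measure.prod_restrict, S3_rect_integral]
    apply setIntegral_congr_fun (measurableSet_Icc.prod measurableSet_Icc)
    intro p hp
    have hs := hsym ((p.1:ℂ) + p.2*I) (hsmall _ (by simpa using abs_le.2 hp.1) (by simpa using abs_le.2 hp.2))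
    have hcj : (starRingEnd ℂ) ((p.1:ℂ) + p.2*I) = (p.1:ℂ) - p.2*I := by
      simp [sub_eq_add_neg]
    rw [hcj] at hs
    simp only [hs, hΦ]
    rw [show ((p.1:ℂ) - p.2*I) + 2*p.2*I = p.1 + p.2*I by ring]
    rw [Complex.re_mul_ofReal, mul_comm]
    simp
  have e2 : ∫ θ in Icc (-t) t, ∫ x in Icc (-L) L, Ψ x θ
      = ∫ x in Icc (-L) L, (g x).re * ((1/2)*Real.exp (-ε*x^2) * ES (rT B b ε t) ε x) := by
    rw [← integral_integral_swap iΨ]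
    apply setIntegral_congr_fun measurableSet_Icc
    intro x hx
    simp only
    rw [← fS_transform, integral_Icc_eq_integral_Ioc, ← intervalIntegral.integral_of_le (by linarith),
      ← intervalIntegral.integral_const_mul]
    congr 1; ext θ
    simp only [hΨ, Complex.mul_re, him x (abs_le.2 hx)]
    ring
  -- lower bound for the axis integral
  have l2 : -(A * 512 * Real.pi * (2*N)) ≤ ∫ θ in Icc (-t) t, ∫ x in Icc (-L) L, Ψ x θ := by
    rw [e2]
    have hI : ∫ x in Icc (-L) L, -(A * 512 * (2*N)) * (1+x^2)⁻¹ ≤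
        ∫ x in Icc (-L) L, (g x).re * ((1/2)*Real.exp (-ε*x^2) * ES (rT B b ε t) ε x) := by
      apply setIntegral_mono_on
      · exact (integrable_inv_one_add_sq.const_mul _).integrableOn
      · have := iΨ.integral_prod_left
        refine this.congr ?_
        rw [Filter.EventuallyEq, ae_restrict_iff' measurableSet_Icc]
        refine Filter.Eventually.of_forall fun x hx => ?_
        rw [← fS_transform, integral_Icc_eq_integral_Ioc, ← intervalIntegral.integral_of_le (by linarith),
          ← intervalIntegral.integral_const_mul]
        congr 1; ext θ
        simp only [hΨ, Function.uncurry, Complex.mul_re, him x (abs_le.2 hx)]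
        ring
      · exact measurableSet_Icc
      · intro x hx
        have hx' := abs_le.2 hx
        have g0 := hpos x hx'
        have g1 : (g x).re ≤ 2*N := by
          have := hptw x (by simpa using hx') (1/2) (by norm_num) (by norm_num) (by rw [Complex.ofReal_im, abs_zero]; linarith)
          have h2 := Complex.re_le_norm (g x)
          linarith
        have h1 := mul_le_mul_of_nonneg_left (hT x) g0
        have h2 := S3_exp_le16 x
        have h3 : (g x).re * (A * Real.exp (-(|x|/16))) ≤ (2*N) * (A * (512 * (1+x^2)⁻¹)) :=
          mul_le_mul g1 (mul_le_mul_of_nonneg_left h2 hA) (by positivity) (by positivity)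
        linarith
    refine le_trans ?_ hI
    rw [integral_const_mul]
    have : ∫ x in Icc (-L) L, (1+x^2)⁻¹ ≤ Real.pi := by
      rw [← integral_univ_inv_one_add_sq]
      apply setIntegral_le_integral integrable_inv_one_add_sq
      exact Filter.Eventually.of_forall fun x => by positivity
    have h0 : 0 ≤ A * 512 * (2*N) := by positivity
    nlinarith
  -- comparison at each height
  have l1 : ∀ θ ∈ Icc (-t) t, (∫ x in Icc (-L) L, Ψ x θ) - M * (Real.pi * D) ≤ ∫ x in Icc (-L) L, Φ x θ := by
    intro θ hθ
    have hθ' := abs_le.2 hθ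
    have hr0 := rhoS_ge b hB (hθ'.trans htpi)
    have hrM := hM θ (hθ'.trans htpi)
    set h : ℂ → ℂ := fun w => fS ε (w + 2*θ*I) * g w with hh
    have hsubr : rectS L |θ| ⊆ Ω := fun u hu => hQ (hsmall u hu.1 (hu.2.trans hθ'))
    have hdiff : DifferentiableOn ℂ h (rectS L |θ|) := by
      refine DifferentiableOn.mul ?_ (hg.mono hsubr)
      exact ((fS_diff ε).comp (by fun_prop : Differentiable ℂ fun w : ℂ => w + 2*θ*I)).differentiableOn
    have hbd : ∀ σ : ℝ, |σ| = L → ∀ y : ℝ, |y| ≤ |θ| → ‖h (σ + y*I)‖ ≤ D := by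
      intro σ hσ y hy
      simp only [hh, norm_mul]
      have hf := fS_bound hε (u := (σ:ℂ) + y*I + 2*θ*I) (by
        simp only [Complex.add_im, Complex.ofReal_im, Complex.mul_im, Complex.I_re, Complex.I_im]
        simp
        refine (abs_add_le _ _).trans ?_
        rw [abs_mul, abs_two]
        linarith)
      have hre : ((σ:ℂ) + y*I + 2*θ*I).re = σ := by simp
      rw [hre, hσ] at hf
      have hgb := hptw ((σ:ℂ) + y*I) (by simp [hσ]) (1/L) hL0 (by linarith) (by
        simp; have := hy.trans hθ'; rw [ht, hL2] at this; rw [← one_div]; linarith)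
      have hgb2 : ‖g ((σ:ℂ) + y*I)‖ ≤ L*N := by
        rw [mul_one_div, div_le_iff₀ (by linarith)] at hgb; linarith
      rw [hD]
      exact mul_le_mul hf hgb2 (norm_nonneg _) (by have := KS_pos ε; positivity)
    have hct := S3_contour (h := h) (L := L) (θ := θ) (D := D) (by linarith) hdiff (fun y hy =>
      ⟨hbd L (abs_of_pos (by linarith)) y hy, by
        have := hbd (-L) (by rw [abs_neg, abs_of_pos (by linarith)]) y hy
        simpa using this⟩)
    have ii1 : IntervalIntegrable (fun x : ℝ => h (x - θ*I)) volume (-L) L := by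
      apply ContinuousOn.intervalIntegrable
      rw [uIcc_of_le (by linarith)]
      refine hdiff.continuousOn.comp (by fun_prop) ?_
      intro x hx
      exact ⟨by simpa using abs_le.2 hx, by simp⟩
    have ii2 : IntervalIntegrable (fun x : ℝ => h x) volume (-L) L := by
      apply ContinuousOn.intervalIntegrable
      rw [uIcc_of_le (by linarith)]
      refine hdiff.continuousOn.comp (by fun_prop) ?_
      intro x hx
      exact ⟨by simpa using abs_le.2 hx, by simp⟩
    have r1 : ∫ x in Icc (-L) L, Φ x θ = rhoS B b θ * (∫ x in (-L)..L, h (x - θ*I)).re := by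
      rw [integral_Icc_eq_integral_Ioc, ← intervalIntegral.integral_of_le (by linarith)]
      simp only [hΦ]
      rw [intervalIntegral.integral_const_mul]
      congr 1
      exact Complex.reCLM.intervalIntegral_comp_comm ii1
    have r2 : ∫ x in Icc (-L) L, Ψ x θ = rhoS B b θ * (∫ x in (-L)..L, h x).re := by
      rw [integral_Icc_eq_integral_Ioc, ← intervalIntegral.integral_of_le (by linarith)]
      simp only [hΨ]
      rw [intervalIntegral.integral_const_mul]
      congr 1
      exact Complex.reCLM.intervalIntegral_comp_comm ii2
    rw [r1, r2]
    have hre := (Complex.abs_re_le_norm _).trans hct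
    rw [Complex.sub_re] at hre
    have h5 := neg_le_of_abs_le hre
    have h6 : 2 * |θ| * D ≤ Real.pi * D := mul_le_mul_of_nonneg_right (by linarith) hD0
    have h7 : rhoS B b θ * (Real.pi * D) ≤ M * (Real.pi * D) := mul_le_mul_of_nonneg_right hrM (by positivity)
    have h8 : rhoS B b θ * (-(Real.pi * D)) ≤ rhoS B b θ * ((∫ x in (-L)..L, h (x - θ*I)).re - (∫ x in (-L)..L, h x).re) :=
      mul_le_mul_of_nonneg_left (by linarith) (by linarith)
    linarith
  rw [e1]
  have jΨ : Integrable (fun θ => ∫ x in Icc (-L) L, Ψ x θ) (volume.restrict (Icc (-t) t)) := iΨ.integral_prod_right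
  have l3 : ∫ θ in Icc (-t) t, ((∫ x in Icc (-L) L, Ψ x θ) - M * (Real.pi * D)) ≤
      ∫ θ in Icc (-t) t, ∫ x in Icc (-L) L, Φ x θ := by
    apply setIntegral_mono_on
    · exact Integrable.sub iΨ.integral_prod_right (integrable_const _)
    · exact iΦ.integral_prod_right
    · exact measurableSet_Icc
    · exact l1
  rw [integral_sub jΨ (integrable_const _)] at l3
  have l4 : ∫ θ in Icc (-t) t, M * (Real.pi * D) ≤ Real.pi * M * (Real.pi * D) := by
    rw [setIntegral_const, Measure.real, Real.volume_Icc, ENNReal.toReal_ofReal (by linarith), smul_eq_mul]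
    have : 0 ≤ M * (Real.pi * D) := by positivity
    nlinarith
  linarith

lemma S3_core_ineq {B b M : ℝ} (hB : 0 < B) (hM1 : 1 ≤ M) (hM : ∀ θ, |θ| ≤ Real.pi/2 → rhoS B b θ ≤ M)
    {ε L A : ℝ} (hε : 0 < ε) (hL : 2 ≤ L) (hA : 0 ≤ A)
    (hT : ∀ x, -(A * Real.exp (-(|x|/16))) ≤
      (1/2)*Real.exp (-ε*x^2) * ES (rT B b ε (Real.pi/2 - 2/L)) ε x)
    (s1 : 2048*Real.pi*A ≤ Real.pi*B/4)
    (s2 : 2*Real.pi^2*M*KS ε*(L*Real.exp (-L)) ≤ Real.pi*B/4)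
    (s3 : 8*(∫ u in stripS \ rectS L (Real.pi/2 - 2/L), ‖fS ε u‖^2 * rhoS B b u.im) ≤ Real.pi*B/4)
    {Ω : Set ℂ} {g : ℂ → ℂ} (hΩ : IsOpen Ω) (hΩS : Ω ⊆ stripS)
    (hQ : rectS (L+1) (Real.pi/2 - 1/L) ⊆ Ω)
    (hg : DifferentiableOn ℂ g Ω) (hgi : IntegrableOn (fun u => ‖g u‖^2 * rhoS B b u.im) Ω)
    (hsym : ∀ u ∈ rectS (L+1) (Real.pi/2 - 1/L), (starRingEnd ℂ) (g u) = g ((starRingEnd ℂ) u))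
    (hpos : ∀ x : ℝ, |x| ≤ L → 0 ≤ (g x).re) (hg0 : g 0 = 1)
    (hrep : ∫ u in Ω, fS ε u * (starRingEnd ℂ) (g u) * (rhoS B b u.im : ℂ)
      = -((∫ u in Ω, ‖g u‖^2 * rhoS B b u.im : ℝ) : ℂ)) : False := by
  have hpi := Real.pi_gt_three
  set G := ∫ u in Ω, ‖g u‖^2 * rhoS B b u.im with hG
  have hL1 : 1/L ≤ 1/2 := by rw [div_le_div_iff₀ (by linarith) (by norm_num)]; linarith
  have hL2 : 2/L = 1/L + 1/L := by ring
  have hL0 : 0 < 1/L := by positivity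
  have hρ : ∀ u ∈ stripS, B ≤ rhoS B b u.im := fun u hu =>
    rhoS_ge b hB (le_of_lt hu : |u.im| ≤ Real.pi/2)
  have hG0 : 0 ≤ G := setIntegral_nonneg hΩ.measurableSet (fun u hu =>
    mul_nonneg (by positivity) (hB.le.trans (hρ u (hΩS hu))))
  set N := Real.sqrt G / Real.sqrt (Real.pi * B) with hN
  have hNG : G = N^2 * (Real.pi * B) := by
    rw [hN, div_pow, Real.sq_sqrt hG0, Real.sq_sqrt (by positivity)]; field_simp
  have hNhalf : 1/2 ≤ N := by
    have := S3_ptw hB hΩ hΩS hg hgi (c := 0) (s := 1/2) (by norm_num) (by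
      refine Subset.trans ?_ hQ
      intro u hu
      rw [mem_closedBall, dist_zero_right] at hu
      have h1 := (Complex.abs_re_le_norm u).trans hu
      have h2 := (Complex.abs_im_le_norm u).trans hu
      exact ⟨by linarith, by linarith⟩)
    rw [hg0] at this
    simpa using this
  have hlow := S3_rect_lower hB hM1 hM hε hL hA hT hΩ hΩS hQ hg hgi hsym hpos hN
  set Q := rectS L (Real.pi/2 - 2/L) with hQdef
  have hQΩ : Q ⊆ Ω := fun u hu => hQ ⟨hu.1.trans (by linarith), hu.2.trans (by linarith)⟩
  set J := ∫ u in stripS \ Q, ‖fS ε u‖^2 * rhoS B b u.im with hJ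
  have hfi := fS_sq_int (b := b) hB hε
  have hfΩ := hfi.mono_set hΩS
  set F : ℂ → ℂ := fun u => fS ε u * (starRingEnd ℂ) (g u) * (rhoS B b u.im : ℂ) with hF
  have hbound : ∀ u ∈ Ω, ‖F u‖ ≤ 2 * (‖fS ε u‖^2 * rhoS B b u.im) + (1/8) * (‖g u‖^2 * rhoS B b u.im) := by
    intro u hu
    have h0 := hρ u (hΩS hu)
    simp only [hF, norm_mul, RCLike.norm_conj, Complex.norm_real, Real.norm_eq_abs]
    rw [abs_of_pos (by linarith : 0 < rhoS B b u.im)]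
    have : ‖fS ε u‖*‖g u‖ ≤ 2*‖fS ε u‖^2 + (1/8)*‖g u‖^2 := by nlinarith [sq_nonneg (4*‖fS ε u‖ - ‖g u‖)]
    nlinarith
  have hFi : IntegrableOn F Ω := by
    refine Integrable.mono' ((hfΩ.const_mul 2).add (hgi.const_mul (1/8))) ?_ ?_
    · apply ContinuousOn.aestronglyMeasurable _ hΩ.measurableSet
      have h1 := (fS_diff ε).continuous
      have h2 := rhoS_cont B b
      have h3 := hg.continuousOn
      refine ContinuousOn.mul (h1.continuousOn.mul (Complex.continuous_conj.comp_continuousOn h3)) ?_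
      exact Continuous.continuousOn (by fun_prop)
    · rw [ae_restrict_iff' hΩ.measurableSet]
      exact Filter.Eventually.of_forall hbound
  have hFr : IntegrableOn (fun u => (F u).re) Ω := hFi.re
  have hre : ∫ u in Ω, (F u).re = -G := by
    have := Complex.reCLM.integral_comp_comm hFi
    simp only [Complex.reCLM_apply] at this
    rw [this, hrep]; simp
  have hsplit : ∫ u in Ω, (F u).re = (∫ u in Q, (F u).re) + ∫ u in Ω \ Q, (F u).re := by
    rw [← setIntegral_union disjoint_sdiff_right (hΩ.measurableSet.diff (rectS_meas _ _))
      (hFr.mono_set hQΩ) (hFr.mono_set sdiff_subset), union_diff_cancel hQΩ]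
  have hrest : -(2*J + (1/8)*G) ≤ ∫ u in Ω \ Q, (F u).re := by
    have h1 : ∫ u in Ω \ Q, -(2 * (‖fS ε u‖^2 * rhoS B b u.im) + (1/8) * (‖g u‖^2 * rhoS B b u.im))
        ≤ ∫ u in Ω \ Q, (F u).re := by
      apply setIntegral_mono_on _ (hFr.mono_set sdiff_subset) (hΩ.measurableSet.diff (rectS_meas _ _))
      · intro u hu
        have := neg_le_of_abs_le ((Complex.abs_re_le_norm (F u)).trans (hbound u hu.1))
        exact this
      · have hn : IntegrableOn (fun u => -(2 * (‖fS ε u‖^2 * rhoS B b u.im) + (1/8) * (‖g u‖^2 * rhoS B b u.im))) Ω :=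
          ((hfΩ.const_mul 2).add (hgi.const_mul (1/8))).neg
        exact hn.mono_set sdiff_subset
    refine le_trans ?_ h1
    have i1 := (hfΩ.mono_set (sdiff_subset : Ω \ Q ⊆ Ω))
    have i2 := (hgi.mono_set (sdiff_subset : Ω \ Q ⊆ Ω))
    rw [integral_neg, integral_add (i1.const_mul 2) (i2.const_mul (1/8)), integral_const_mul, integral_const_mul]
    have j1 : ∫ u in Ω \ Q, ‖fS ε u‖^2 * rhoS B b u.im ≤ J := by
      apply setIntegral_mono_set (hfi.mono_set sdiff_subset) _ (sdiff_subset_sdiff_left hΩS).eventuallyLE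
      rw [Filter.EventuallyLE, ae_restrict_iff' (stripS_open.measurableSet.diff (rectS_meas _ _))]
      refine Filter.Eventually.of_forall fun u hu => ?_
      exact mul_nonneg (by positivity) (hB.le.trans (hρ u hu.1))
    have j2 : ∫ u in Ω \ Q, ‖g u‖^2 * rhoS B b u.im ≤ G := by
      apply setIntegral_mono_set hgi _ sdiff_subset.eventuallyLE
      rw [Filter.EventuallyLE, ae_restrict_iff' hΩ.measurableSet]
      refine Filter.Eventually.of_forall fun u hu => ?_
      exact mul_nonneg (by positivity) (hB.le.trans (hρ u (hΩS hu)))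
    linarith
  have hfin : G ≤ 2*J + (1/8)*G + A*512*Real.pi*(2*N) + Real.pi * M * (Real.pi * (KS ε * Real.exp (-L) * (L*N))) := by
    rw [hsplit] at hre
    linarith
  have n1 : 1 ≤ 4*N^2 := by nlinarith
  have n2 : N ≤ 2*N^2 := by nlinarith
  have t1 : A*512*Real.pi*(2*N) ≤ (Real.pi*B/4) * N^2 := by
    have : A*512*Real.pi*(2*N) ≤ A*512*Real.pi*(2*(2*N^2)) := by gcongr
    nlinarith [sq_nonneg N]
  have t2 : Real.pi * M * (Real.pi * (KS ε * Real.exp (-L) * (L*N))) ≤ (Real.pi*B/4)*N^2 := by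
    have hk := KS_pos ε
    have : Real.pi * M * (Real.pi * (KS ε * Real.exp (-L) * (L*N))) ≤
      Real.pi * M * (Real.pi * (KS ε * Real.exp (-L) * (L*(2*N^2)))) := by gcongr
    have h2 := mul_le_mul_of_nonneg_right s2 (sq_nonneg N)
    linarith
  have hJ0 : 0 ≤ J := setIntegral_nonneg (stripS_open.measurableSet.diff (rectS_meas _ _)) (fun u hu =>
    mul_nonneg (by positivity) (hB.le.trans (hρ u hu.1)))
  have t3 : 2*J ≤ (Real.pi*B/4)*N^2 := by
    have : 2*J ≤ 8*J*N^2 := by nlinarith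
    have := mul_le_mul_of_nonneg_right s3 (sq_nonneg N)
    linarith
  have hpos2 : 0 < Real.pi*B*N^2 := by positivity
  linarith

/-- The core obstruction in the strip. -/
theorem S3_strip_core : ∃ (B b ε L : ℝ), 0 < B ∧ 2 ≤ L ∧ 
    ∀ (Ω : Set ℂ) (g : ℂ → ℂ), IsOpen Ω → Ω ⊆ stripS → rectS (L+1) (Real.pi/2 - 1/L) ⊆ Ω →
    DifferentiableOn ℂ g Ω → IntegrableOn (fun u => ‖g u‖^2 * rhoS B b u.im) Ω →
    (∀ u ∈ rectS (L+1) (Real.pi/2 - 1/L), (starRingEnd ℂ) (g u) = g ((starRingEnd ℂ) u)) →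
    (∀ x : ℝ, |x| ≤ L → 0 ≤ (g x).re) → g 0 = 1 →
    (∫ u in Ω, fS ε u * (starRingEnd ℂ) (g u) * (rhoS B b u.im : ℂ)
      = -((∫ u in Ω, ‖g u‖^2 * rhoS B b u.im : ℝ) : ℂ)) → False := by
  obtain ⟨B, b, m, hB, hm, hr, hk⟩ := exists_profile
  obtain ⟨M, hM1, hM⟩ := rhoS_bdd B b
  have hpi := Real.pi_gt_three
  set C := Real.pi * M * Real.exp (Real.pi^2) with hC
  have hC0 : 0 < C := by rw [hC]; positivity
  set X0 := 2*(5*C/(m/4)) with hX0d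
  have hX0 : 0 ≤ X0 := by rw [hX0d]; positivity
  have hX : 5*C/(m/4) ≤ Real.exp (X0/2) := by
    rw [hX0d]; have := Real.add_one_le_exp (5*C/(m/4))
    rw [show 2*(5*C/(m/4))/2 = 5*C/(m/4) by ring]; linarith
  -- choice of ε
  have ev : ∀ᶠ ε in nhdsWithin (0:ℝ) (Ioi 0), 0 < ε ∧ ε ≤ 1 ∧ 6*(Real.pi*C)*ε*X0 ≤ m/4 ∧
      M*(Real.pi*(Real.exp (ε*Real.pi^2) - 1)) ≤ m/8 ∧
      2048*Real.pi*(3*C*Real.exp (-(17/(128*ε)))) ≤ Real.pi*B/4 := by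
    have e0 : ∀ᶠ ε in nhdsWithin (0:ℝ) (Ioi 0), 0 < ε := self_mem_nhdsWithin
    have e1 : ∀ᶠ ε in nhdsWithin (0:ℝ) (Ioi 0), ε < 1 :=
      nhdsWithin_le_nhds (gt_mem_nhds (by norm_num))
    have t2 : Filter.Tendsto (fun ε : ℝ => 6*(Real.pi*C)*ε*X0) (nhdsWithin 0 (Ioi 0)) (nhds 0) := by
      have : Continuous (fun ε : ℝ => 6*(Real.pi*C)*ε*X0) := by fun_prop
      have := this.tendsto 0
      simp only [mul_zero, zero_mul] at this
      exact this.mono_left nhdsWithin_le_nhds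
    have t3 : Filter.Tendsto (fun ε : ℝ => M*(Real.pi*(Real.exp (ε*Real.pi^2) - 1))) (nhdsWithin 0 (Ioi 0)) (nhds 0) := by
      have : Continuous (fun ε : ℝ => M*(Real.pi*(Real.exp (ε*Real.pi^2) - 1))) := by fun_prop
      have := this.tendsto 0
      simp only [zero_mul, Real.exp_zero, sub_self, mul_zero] at this
      exact this.mono_left nhdsWithin_le_nhds
    have t4 : Filter.Tendsto (fun ε : ℝ => 2048*Real.pi*(3*C*Real.exp (-(17/(128*ε))))) (nhdsWithin 0 (Ioi 0)) (nhds 0) := by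
      have h1 : Filter.Tendsto (fun ε : ℝ => 17/128 * ε⁻¹) (nhdsWithin 0 (Ioi 0)) Filter.atTop :=
        Filter.Tendsto.const_mul_atTop (by norm_num) tendsto_inv_nhdsGT_zero
      have h2 := Real.tendsto_exp_neg_atTop_nhds_zero.comp h1
      have h3 := h2.const_mul (2048*Real.pi*(3*C))
      rw [mul_zero] at h3
      refine h3.congr (fun ε => ?_)
      simp only [Function.comp]
      rw [show 17/128 * ε⁻¹ = 17/(128*ε) by rw [← div_eq_mul_inv, div_div]]
      ring
    filter_upwards [e0, e1, t2.eventually (gt_mem_nhds (by positivity : 0 < m/4)),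
      t3.eventually (gt_mem_nhds (by positivity : 0 < m/8)),
      t4.eventually (gt_mem_nhds (by positivity : 0 < Real.pi*B/4))] with ε a0 a1 a2 a3 a4
    exact ⟨a0, a1.le, a2.le, a3.le, a4.le⟩
  obtain ⟨ε, hε, hε1, hεX, hε3, hε4⟩ := ev.exists
  have evL : ∀ᶠ n : ℕ in Filter.atTop, 2 ≤ ((n:ℝ)+1) ∧ M*(4/((n:ℝ)+1)) ≤ m/8 ∧
      2*Real.pi^2*M*KS ε*(((n:ℝ)+1)*Real.exp (-((n:ℝ)+1))) ≤ Real.pi*B/4 ∧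
      8*(∫ u in stripS \ rectS (n+1) (Real.pi/2 - 2/(n+1)), ‖fS ε u‖^2 * rhoS B b u.im) ≤ Real.pi*B/4 := by
    have tn : Filter.Tendsto (fun n : ℕ => (n:ℝ)+1) Filter.atTop Filter.atTop :=
      Filter.tendsto_atTop_add_const_right _ _ tendsto_natCast_atTop_atTop
    have t1 : Filter.Tendsto (fun n : ℕ => M*(4/((n:ℝ)+1))) Filter.atTop (nhds 0) := by
      have := (Filter.Tendsto.const_div_atTop tn 4).const_mul M
      rwa [mul_zero] at this
    have t2 : Filter.Tendsto (fun n : ℕ => 2*Real.pi^2*M*KS ε*(((n:ℝ)+1)*Real.exp (-((n:ℝ)+1)))) Filter.atTop (nhds 0) := by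
      have h0 := Real.tendsto_pow_mul_exp_neg_atTop_nhds_zero 1
      have := (h0.comp tn).const_mul (2*Real.pi^2*M*KS ε)
      rw [mul_zero] at this
      simpa [Function.comp] using this
    have t3 := (fS_tail (b := b) hB hε).const_mul 8
    rw [mul_zero] at t3
    filter_upwards [tn.eventually_ge_atTop 2, t1.eventually (gt_mem_nhds (by positivity : 0 < m/8)),
      t2.eventually (gt_mem_nhds (by positivity : 0 < Real.pi*B/4)),
      t3.eventually (gt_mem_nhds (by positivity : 0 < Real.pi*B/4))] with n a0 a1 a2 a3
    exact ⟨a0, a1.le, a2.le, a3.le⟩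
  obtain ⟨n, hn, hn1, hn2, hn3⟩ := evL.exists
  set L : ℝ := (n:ℝ)+1 with hLd
  refine ⟨B, b, ε, L, hB, hn, ?_⟩
  intro Ω g hΩ hΩS hQ hg hgi hsym hpos hg0 hrep
  have h2L : 0 < 2/L := by positivity
  have h2L1 : 2/L ≤ 1 := by rw [div_le_one (by linarith)]; exact hn
  have ht0 : 0 ≤ Real.pi/2 - 2/L := by linarith
  have ht1 : Real.pi/2 - 2/L ≤ Real.pi/2 := by linarith
  have hexp : Real.pi * M * Real.exp (ε*Real.pi^2) ≤ C := by
    rw [hC]; apply mul_le_mul_of_nonneg_left _ (by positivity)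
    apply Real.exp_le_exp.2; nlinarith [sq_nonneg Real.pi]
  have hcl : ∀ y, |rT B b ε (Real.pi/2 - 2/L) y - rS B b y| ≤ m/4 := by
    intro y
    refine (rT_close hB hM1 hM hε ht0 ht1 y).trans ?_
    have : M*(4/L) = M * (Real.pi - 2*(Real.pi/2 - 2/L)) := by ring
    rw [mul_add, ← this]; linarith
  have hT := ES_lower (r := rT B b ε (Real.pi/2 - 2/L)) (C := C) (Lp := Real.pi*C) (m := m/4) (X0 := X0) hε
    (by positivity) (rT_even _ _ _ _) (fun y => (rT_bound hB hM1 hM hε ht0 ht1 y).trans hexp)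
    (fun y y' => (rT_lip hB hM1 hM hε ht0 ht1 y y').trans (by gcongr)) (by positivity) hX0
    (fun y hy => by have := abs_le.1 (hcl y); have := hr y hy; linarith)
    (by have := abs_le.1 (hcl 2); have := abs_le.1 (hcl (3/2)); linarith) hX hεX
  exact S3_core_ineq hB hM1 hM hε hn (by positivity) hT hε4 hn2 hn3 hΩ hΩS hQ hg hgi hsym hpos hg0 hrep

lemma lapR_eq {u : ℂ → ℝ} {z : ℂ} (h : ContDiffAt ℝ 2 u z) :
    lapR u z = (1/4) * Laplacian.laplacian u z := by
  have hd : DifferentiableAt ℝ (fderiv ℝ u) z :=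
    (h.fderiv_right (m := 1) (by norm_num)).differentiableAt (by norm_num)
  have key : ∀ v : ℂ, fderiv ℝ (fun w => fderiv ℝ u w v) z v = fderiv ℝ (fderiv ℝ u) z v v := by
    intro v
    rw [fderiv_clm_apply hd (differentiableAt_const v)]
    simp
  unfold lapR
  rw [key, key, InnerProductSpace.laplacian_eq_iteratedFDeriv_complexPlane]
  simp [iteratedFDeriv_two_apply]

lemma lapR_congr {u v : ℂ → ℝ} {z : ℂ} (h : u =ᶠ[nhds z] v) : lapR u z = lapR v z := by
  have h1 := h.fderiv (𝕜 := ℝ)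
  have h2 : ∀ w : ℂ, fderiv ℝ (fun x => fderiv ℝ u x w) z = fderiv ℝ (fun x => fderiv ℝ v x w) z := by
    intro w
    apply Filter.EventuallyEq.fderiv_eq
    filter_upwards [h1] with x hx
    rw [hx]
  unfold lapR
  rw [h2, h2]

lemma lapR_add {u v : ℂ → ℝ} {z : ℂ} (hu : ContDiffAt ℝ 2 u z) (hv : ContDiffAt ℝ 2 v z) :
    lapR (fun w => u w + v w) z = lapR u z + lapR v z := by
  have := hu.laplacian_add hv
  rw [lapR_eq (hu.add hv), lapR_eq hu, lapR_eq hv, ← mul_add, ← this]; rfl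

lemma lapR_sub {u v : ℂ → ℝ} {z : ℂ} (hu : ContDiffAt ℝ 2 u z) (hv : ContDiffAt ℝ 2 v z) :
    lapR (fun w => u w - v w) z = lapR u z - lapR v z := by
  have h := lapR_add (u := fun w => u w - v w) (v := v) (hu.sub hv) hv
  simp only [sub_add_cancel] at h
  linarith [h, show lapR (fun w => u w) z = lapR u z from rfl]

lemma lapR_re {p : ℂ → ℂ} {z : ℂ} (hp : AnalyticAt ℂ p z) :
    lapR (fun w => (p w).re) z = 0 := by
  have h := hp.harmonicAt_re
  have := h.2.eq_of_nhds
  rw [lapR_eq h.1, show Laplacian.laplacian (fun w => (p w).re) z = 0 from this]; simp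

lemma S3_ofBall {ω : ℂ → ℝ} (h : ContDiffOn ℝ (⊤ : ℕ∞) ω closedDisk) {z : ℂ} (hz : z ∈ unitDisk) :
    ContDiffAt ℝ 2 ω z := by
  have h1 : ContDiffAt ℝ (⊤ : ℕ∞) ω z := h.contDiffAt
    (Filter.mem_of_superset (Metric.isOpen_ball.mem_nhds hz) Metric.ball_subset_closedBall)
  exact h1.of_le (WithTop.coe_le_coe.2 (le_top : (2:ℕ∞) ≤ ⊤))

lemma S3_logsm {ω : ℂ → ℝ} (h : ContDiffOn ℝ (⊤ : ℕ∞) ω closedDisk)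
    (hp : ∀ z ∈ closedDisk, 0 < ω z) {z : ℂ} (hz : z ∈ unitDisk) :
    ContDiffAt ℝ 2 (fun z => Real.log (ω z)) z :=
  (S3_ofBall h hz).log (hp z (Metric.ball_subset_closedBall hz)).ne'

/-- Integrability on the disk of continuous functions on the closed disk. -/
lemma S3_int {E : Type*} [NormedAddCommGroup E] {f : ℂ → E} (h : ContinuousOn f closedDisk) :
    IntegrableOn f unitDisk dSigma := by
  have : IntegrableOn f closedDisk volume :=
    h.integrableOn_compact (isCompact_closedBall _ _)
  have h2 := this.mono_set (Metric.ball_subset_closedBall : Metric.ball (0:ℂ) 1 ⊆ _)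
  unfold IntegrableOn dSigma at *
  rw [Measure.restrict_smul]
  exact h2.smul_measure (by simp)

lemma S3_meas_disk : MeasurableSet unitDisk := Metric.isOpen_ball.measurableSet

/-- Optimality predicate for the problem (OP). -/
def S3Opt (μ ω₀ : ℂ → ℝ) : Prop := (∀ z ∈ closedDisk, 0 < ω₀ z) ∧ ContDiffOn ℝ (⊤ : ℕ∞) ω₀ closedDisk ∧
          (∀ z ∈ unitDisk, lapR (fun z => Real.log (ω₀ z)) z = -μ z / 2) ∧
          (∫ z in unitDisk, ω₀ z ∂dSigma) = 1 ∧
          (∀ ω : ℂ → ℝ, (∀ z ∈ closedDisk, 0 < ω z) → ContDiffOn ℝ (⊤ : ℕ∞) ω closedDisk →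
            (∀ z ∈ unitDisk, lapR (fun z => Real.log (ω z)) z = -μ z / 2) →
            (∫ z in unitDisk, ω z ∂dSigma) = 1 → ω 0 ≤ ω₀ 0)

lemma S3_sub_ball {R : ℝ} (hR : 1 < R) : closedDisk ⊆ Metric.ball (0:ℂ) R := by
  intro z hz
  simp [closedDisk] at hz ⊢; linarith

lemma S3_resm {R : ℝ} (hR : 1 < R) {p : ℂ → ℂ} (hp : DifferentiableOn ℂ p (Metric.ball 0 R)) :
    ContDiffOn ℝ (⊤ : ℕ∞) (fun z => (p z).re) closedDisk := by
  have h1 : ContDiffOn ℂ (⊤ : ℕ∞) p (Metric.ball 0 R) := hp.contDiffOn Metric.isOpen_ball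
  have h2 : ContDiffOn ℝ (⊤ : ℕ∞) p (Metric.ball 0 R) := h1.restrict_scalars ℝ
  exact (Complex.reCLM.contDiff.comp_contDiffOn h2).mono (S3_sub_ball hR)

lemma S3_var {μ ω₀ : ℂ → ℝ} (h : S3Opt μ ω₀) {R : ℝ} (hR : 1 < R) {p : ℂ → ℂ}
    (hp : DifferentiableOn ℂ p (Metric.ball 0 R)) :
    Real.exp ((p 0).re) ≤ ∫ z in unitDisk, ω₀ z * Real.exp ((p z).re) ∂dSigma := by
  obtain ⟨hpos, hsm, hlap, hIntg, hopt⟩ := h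
  have hre := S3_resm hR hp
  have hsm1 : ContDiffOn ℝ (⊤ : ℕ∞) (fun z => ω₀ z * Real.exp ((p z).re)) closedDisk :=
    hsm.mul hre.exp
  have hI1 : IntegrableOn (fun z => ω₀ z * Real.exp ((p z).re)) unitDisk dSigma :=
    S3_int hsm1.continuousOn
  have hI0 : IntegrableOn ω₀ unitDisk dSigma := S3_int hsm.continuousOn
  set Z := ∫ z in unitDisk, ω₀ z * Real.exp ((p z).re) ∂dSigma with hZ
  have h0d : (0:ℂ) ∈ unitDisk := by simp [unitDisk]
  have h0c : (0:ℂ) ∈ closedDisk := by simp [closedDisk]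
  have hZpos : 0 < Z := by
    obtain ⟨z0, hz0, hmin⟩ := (isCompact_closedBall (0:ℂ) 1).exists_isMinOn ⟨0, h0c⟩
      (hre.exp.continuousOn)
    have : ∫ z in unitDisk, ω₀ z * Real.exp ((p z0).re) ∂dSigma ≤ Z := by
      apply setIntegral_mono_on (hI0.mul_const _) hI1 S3_meas_disk
      intro z hz
      have hz' : z ∈ closedDisk := Metric.ball_subset_closedBall hz
      exact mul_le_mul_of_nonneg_left (hmin hz') (hpos z hz').le
    rw [integral_mul_const, hIntg, one_mul] at this
    exact (Real.exp_pos _).trans_le this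
  have key := hopt (fun z => ω₀ z * Real.exp ((p z).re) / Z) ?_ ?_ ?_ ?_
  · have h0 := hpos 0 h0c
    rw [div_le_iff₀ hZpos] at key
    exact le_of_mul_le_mul_left key h0
  · intro z hz; have := hpos z hz; positivity
  · exact hsm1.div_const Z
  · intro z hz
    have hnh : unitDisk ∈ nhds z := Metric.isOpen_ball.mem_nhds hz
    have han : AnalyticAt ℂ (fun w => p w - (Real.log Z : ℂ)) z := by
      have : AnalyticAt ℂ p z := hp.analyticAt
        (Metric.isOpen_ball.mem_nhds (S3_sub_ball hR (Metric.ball_subset_closedBall hz)))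
      exact this.sub analyticAt_const
    have : (fun z => Real.log (ω₀ z * Real.exp ((p z).re) / Z)) =ᶠ[nhds z]
        (fun w => Real.log (ω₀ w) + (p w - (Real.log Z : ℂ)).re) := by
      filter_upwards [hnh] with w hw
      have h1 := hpos w (Metric.ball_subset_closedBall hw)
      rw [Real.log_div (by positivity) hZpos.ne', Real.log_mul h1.ne' (by positivity), Real.log_exp]
      simp; ring
    rw [lapR_congr this, lapR_add (S3_logsm hsm hpos hz) han.harmonicAt_re.1, lapR_re han,
      hlap z hz, add_zero]
  · rw [integral_div, ← hZ, div_self hZpos.ne']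

lemma S3_exp_quad {s : ℝ} (hs : |s| ≤ 1) : Real.exp s ≤ 1 + s + s^2 := by
  have := Real.abs_exp_sub_one_sub_id_le hs
  have := (abs_le.1 this).2
  linarith

lemma S3_var_re {μ ω₀ : ℂ → ℝ} (h : S3Opt μ ω₀) {R : ℝ} (hR : 1 < R) {p : ℂ → ℂ}
    (hp : DifferentiableOn ℂ p (Metric.ball 0 R)) (hp0 : p 0 = 0) :
    ∫ z in unitDisk, ω₀ z * (p z).re ∂dSigma = 0 := by
  have hre := (S3_resm hR hp).continuousOn
  have hc0 := h.2.1.continuousOn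
  obtain ⟨M0, hM0⟩ := (isCompact_closedBall (0:ℂ) 1).exists_bound_of_continuousOn hre
  set M := max M0 1 with hMdef
  have hM1 : 1 ≤ M := le_max_right _ _
  have hM : ∀ z ∈ closedDisk, |(p z).re| ≤ M := fun z hz => (hM0 z hz).trans (le_max_left _ _)
  set A := ∫ z in unitDisk, ω₀ z * (p z).re ∂dSigma with hA
  have hI0 : IntegrableOn ω₀ unitDisk dSigma := S3_int hc0
  have hI1 : IntegrableOn (fun z => ω₀ z * (p z).re) unitDisk dSigma := S3_int (hc0.mul hre)
  have hIntg : ∫ z in unitDisk, ω₀ z ∂dSigma = 1 := h.2.2.2.1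
  have hcd : unitDisk ⊆ closedDisk := Metric.ball_subset_closedBall
  have hAM : |A| ≤ M := by
    have h1 : |A| ≤ ∫ z in unitDisk, ω₀ z * M ∂dSigma := by
      rw [hA, ← Real.norm_eq_abs]
      apply norm_integral_le_of_norm_le (hI0.mul_const M)
      filter_upwards [ae_restrict_mem S3_meas_disk] with z hz
      have := h.1 z (hcd hz)
      rw [Real.norm_eq_abs, abs_mul, abs_of_pos this]
      exact mul_le_mul_of_nonneg_left (hM z (hcd hz)) this.le
    rwa [integral_mul_const, hIntg, one_mul] at h1
  have key : ∀ t : ℝ, |t| * M ≤ 1 → 0 ≤ t * A + t^2 * M^2 := by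
    intro t ht
    have h1 := S3_var h hR (p := fun z => (t:ℂ) * p z) (hp.const_mul _)
    simp only [hp0, mul_zero, Complex.zero_re, Real.exp_zero, Complex.re_ofReal_mul] at h1
    have hI2 : IntegrableOn (fun z => ω₀ z + t * (ω₀ z * (p z).re)) unitDisk dSigma :=
      hI0.add (hI1.const_mul t)
    have h2 : ∫ z in unitDisk, ω₀ z * Real.exp (t * (p z).re) ∂dSigma ≤
        ∫ z in unitDisk, (ω₀ z + t * (ω₀ z * (p z).re) + ω₀ z * (t^2*M^2)) ∂dSigma := by
      apply setIntegral_mono_on _ (hI2.add (hI0.mul_const _)) S3_meas_disk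
      · intro z hz
        have h3 := h.1 z (hcd hz)
        have h4 : |t * (p z).re| ≤ |t| * M := by
          rw [abs_mul]; exact mul_le_mul_of_nonneg_left (hM z (hcd hz)) (abs_nonneg _)
        have h5 := S3_exp_quad (h4.trans ht)
        have h6 : (t * (p z).re)^2 ≤ t^2*M^2 := by
          rw [← sq_abs, ← sq_abs t, ← mul_pow]
          exact pow_le_pow_left₀ (abs_nonneg _) h4 2
        calc ω₀ z * Real.exp (t * (p z).re) ≤ ω₀ z * (1 + t * (p z).re + t^2*M^2) :=
              mul_le_mul_of_nonneg_left (by linarith) h3.le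
          _ = _ := by simp only [Pi.add_apply]; ring
      · exact S3_int (hc0.mul ((continuousOn_const.mul hre).rexp))
    rw [integral_add hI2 (hI0.mul_const _),
      integral_add hI0 (hI1.const_mul t), integral_const_mul, integral_mul_const, hIntg, ← hA] at h2
    linarith
  have hk := key (-A/(2*M^2)) (by
    rw [abs_div, abs_neg, abs_of_pos (by positivity : (0:ℝ) < 2*M^2), div_mul_eq_mul_div,
      div_le_one (by positivity)]
    nlinarith)
  have h7 : -A/(2*M^2) * A + (-A/(2*M^2))^2*M^2 = -(A^2/(4*M^2)) := by field_simp; ring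
  rw [h7] at hk
  have h8 : A^2/(4*M^2) = 0 := le_antisymm (by linarith) (by positivity)
  rcases div_eq_zero_iff.1 h8 with h9 | h9
  · exact pow_eq_zero_iff (two_ne_zero) |>.1 h9
  · exfalso; have : 0 < 4*M^2 := by positivity
    linarith

lemma S3_var_c {μ ω₀ : ℂ → ℝ} (h : S3Opt μ ω₀) {R : ℝ} (hR : 1 < R) {p : ℂ → ℂ}
    (hp : DifferentiableOn ℂ p (Metric.ball 0 R)) :
    ∫ z in unitDisk, (ω₀ z : ℂ) * p z ∂dSigma = p 0 := by
  have hpc : ContinuousOn p closedDisk := hp.continuousOn.mono (S3_sub_ball hR)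
  have hc0 : ContinuousOn (fun z => (ω₀ z : ℂ)) closedDisk :=
    Complex.continuous_ofReal.comp_continuousOn h.2.1.continuousOn
  have hI0 : IntegrableOn (fun z => (ω₀ z : ℂ)) unitDisk dSigma := S3_int hc0
  have hI : IntegrableOn (fun z => (ω₀ z : ℂ) * (p z - p 0)) unitDisk dSigma :=
    S3_int (hc0.mul (hpc.sub continuousOn_const))
  have hIntg : ∫ z in unitDisk, (ω₀ z : ℂ) ∂dSigma = 1 := by
    rw [integral_complex_ofReal, h.2.2.2.1]; simp
  have hz : ∫ z in unitDisk, (ω₀ z : ℂ) * (p z - p 0) ∂dSigma = 0 := by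
    apply Complex.ext
    · have h1 := S3_var_re h hR (p := fun z => p z - p 0) (hp.sub_const _) (by simp)
      have h2 := (integral_re hI)
      simp only [RCLike.re_eq_complex_re, Complex.re_ofReal_mul] at h2
      rw [← h2, h1]; simp
    · have h1 := S3_var_re h hR (p := fun z => -Complex.I * (p z - p 0))
        ((hp.sub_const _).const_mul _) (by simp)
      have h2 := (integral_im hI)
      simp only [RCLike.im_eq_complex_im, Complex.im_ofReal_mul] at h2
      rw [← h2, Complex.zero_im, ← h1]
      congr 1; ext z; simp
  have h3 : ∫ z in unitDisk, (ω₀ z : ℂ) * p z ∂dSigma =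
      ∫ z in unitDisk, ((ω₀ z : ℂ) * (p z - p 0) + (ω₀ z : ℂ) * p 0) ∂dSigma := by
    congr 1; ext z; ring
  rw [h3, integral_add hI (hI0.mul_const _), hz, integral_mul_const, hIntg]; simp

lemma S3_var_bdd {μ ω₀ : ℂ → ℝ} (h : S3Opt μ ω₀) {p : ℂ → ℂ}
    (hp : DifferentiableOn ℂ p unitDisk) {M : ℝ} (hM : ∀ z ∈ unitDisk, ‖p z‖ ≤ M) :
    ∫ z in unitDisk, (ω₀ z : ℂ) * p z ∂dSigma = p 0 := by
  have hI0 : IntegrableOn ω₀ unitDisk dSigma := S3_int h.2.1.continuousOn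
  set s : ℕ → ℝ := fun n => 1 - 1/((n:ℝ)+2) with hs
  have hs0 : ∀ n, 0 < s n ∧ s n < 1 := by
    intro n
    have h1 : (0:ℝ) < 1/((n:ℝ)+2) := by positivity
    have h2 : 1/((n:ℝ)+2) < 1 := by
      rw [div_lt_one (by positivity)]; have : (0:ℝ) ≤ n := Nat.cast_nonneg n
      linarith
    exact ⟨by simp only [hs]; linarith, by simp only [hs]; linarith⟩
  have hsl : Filter.Tendsto s Filter.atTop (nhds 1) := by
    have h1 : Filter.Tendsto (fun n : ℕ => 1/((n:ℝ)+2)) Filter.atTop (nhds 0) :=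
      tendsto_const_nhds.div_atTop (Filter.tendsto_atTop_add_const_right _ _ tendsto_natCast_atTop_atTop)
    simpa [hs] using (tendsto_const_nhds (x := (1:ℝ))).sub h1
  have hin : ∀ n, ∀ z ∈ unitDisk, (s n : ℂ) * z ∈ unitDisk := by
    intro n z hz
    simp only [unitDisk, mem_ball_zero_iff, norm_mul, Complex.norm_real, Real.norm_eq_abs,
      abs_of_pos (hs0 n).1] at hz ⊢
    nlinarith [(hs0 n).1, (hs0 n).2, norm_nonneg z]
  have hIntg : ∀ n, ∫ z in unitDisk, (ω₀ z : ℂ) * p (s n * z) ∂dSigma = p 0 := by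
    intro n
    have hR : 1 < 1 / s n := by rw [lt_div_iff₀ (hs0 n).1]; linarith [(hs0 n).2]
    have := S3_var_c h hR (p := fun z => p (s n * z)) ?_
    · simpa using this
    · apply hp.comp (by fun_prop)
      intro z hz
      simp only [unitDisk, mem_ball_zero_iff, norm_mul, Complex.norm_real, Real.norm_eq_abs,
        abs_of_pos (hs0 n).1] at hz ⊢
      rw [lt_div_iff₀ (hs0 n).1] at hz; linarith
  have hlim : Filter.Tendsto (fun n => ∫ z in unitDisk, (ω₀ z : ℂ) * p (s n * z) ∂dSigma)
      Filter.atTop (nhds (∫ z in unitDisk, (ω₀ z : ℂ) * p z ∂dSigma)) := by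
    apply tendsto_integral_of_dominated_convergence (fun z => ω₀ z * M)
    · intro n
      apply ContinuousOn.aestronglyMeasurable _ S3_meas_disk
      apply ContinuousOn.mul
      · exact Complex.continuous_ofReal.comp_continuousOn
          (h.2.1.continuousOn.mono Metric.ball_subset_closedBall)
      · exact hp.continuousOn.comp (by fun_prop) (hin n)
    · exact hI0.mul_const M
    · intro n
      filter_upwards [ae_restrict_mem S3_meas_disk] with z hz
      have := h.1 z (Metric.ball_subset_closedBall hz)
      rw [norm_mul, Complex.norm_real, Real.norm_eq_abs, abs_of_pos this]
      exact mul_le_mul_of_nonneg_left (hM _ (hin n z hz)) this.le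
    · filter_upwards [ae_restrict_mem S3_meas_disk] with z hz
      apply Filter.Tendsto.const_mul
      have hc : ContinuousAt p z := hp.continuousOn.continuousAt (Metric.isOpen_ball.mem_nhds hz)
      apply hc.tendsto.comp
      have : Filter.Tendsto (fun n => (s n : ℂ) * z) Filter.atTop (nhds (((1:ℝ):ℂ) * z)) :=
        ((Complex.continuous_ofReal.tendsto 1).comp hsl).mul_const z
      simpa using this
  exact (tendsto_nhds_unique hlim (by simp only [hIntg]; exact tendsto_const_nhds))

lemma S3_rep {μ ω ω₀ : ℂ → ℝ} (h : S3Opt μ ω₀) (hpos : ∀ z ∈ closedDisk, 0 < ω z)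
    (hsm : ContDiffOn ℝ (⊤ : ℕ∞) ω closedDisk)
    (hlap : ∀ z ∈ unitDisk, lapR (fun z => Real.log (ω z)) z = -μ z / 2) :
    ∃ g : ℂ → ℂ, ∃ a M : ℝ, DifferentiableOn ℂ g unitDisk ∧ (∀ z, g z ≠ 0) ∧
      (∀ z ∈ unitDisk, ‖g z‖ ≤ M) ∧ 0 < a ∧ g 0 = a ∧
      ∀ F : ℂ → ℂ, DifferentiableOn ℂ F unitDisk → (∃ M', ∀ z ∈ unitDisk, ‖F z‖ ≤ M') →
        ∫ z in unitDisk, F z * (starRingEnd ℂ) (g z) * (ω z : ℂ) ∂dSigma = F 0 / a := by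
  have h0pos := h.1
  have h0sm := h.2.1
  have hharm : InnerProductSpace.HarmonicOnNhd
      (fun z => Real.log (ω₀ z) - Real.log (ω z)) (Metric.ball 0 1) := by
    have hcd : ∀ w ∈ unitDisk, ContDiffAt ℝ 2 (fun z => Real.log (ω₀ z) - Real.log (ω z)) w :=
      fun w hw => (S3_logsm h0sm h0pos hw).sub (S3_logsm hsm hpos hw)
    intro z hz
    refine ⟨hcd z hz, ?_⟩
    filter_upwards [Metric.isOpen_ball.mem_nhds hz] with w hw
    have h1 := lapR_sub (S3_logsm h0sm h0pos hw) (S3_logsm hsm hpos hw)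
    rw [h.2.2.1 w hw, hlap w hw, sub_self, lapR_eq (hcd w hw)] at h1
    simpa using h1
  obtain ⟨H, hH, hHre⟩ := hharm.exists_analyticOnNhd_ball_re_eq
  set g : ℂ → ℂ := fun z => Complex.exp ((H z - Complex.I * (H 0).im)/2) with hg
  have hgd : DifferentiableOn ℂ g unitDisk := by
    have : DifferentiableOn ℂ H unitDisk := hH.differentiableOn
    exact ((this.sub_const _).div_const _).cexp
  have hsq : ∀ z ∈ unitDisk, ‖g z‖^2 = ω₀ z / ω z := by
    intro z hz
    have h1 := h0pos z (Metric.ball_subset_closedBall hz)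
    have h2 := hpos z (Metric.ball_subset_closedBall hz)
    have h3 : (H z).re = Real.log (ω₀ z) - Real.log (ω z) := hHre hz
    rw [hg, Complex.norm_exp, ← Real.exp_nat_mul]
    rw [show ((2:ℕ):ℝ) * ((H z - Complex.I * (H 0).im)/2).re = (H z).re by simp; ring, h3,
      Real.exp_sub, Real.exp_log h1, Real.exp_log h2]
  have hqc : ContinuousOn (fun z => ω₀ z / ω z) closedDisk :=
    h0sm.continuousOn.div hsm.continuousOn (fun z hz => (hpos z hz).ne')
  have hne : closedDisk.Nonempty := ⟨0, by simp [closedDisk]⟩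
  obtain ⟨z1, hz1, hmin⟩ := (isCompact_closedBall (0:ℂ) 1).exists_isMinOn hne hqc
  obtain ⟨z2, hz2, hmax⟩ := (isCompact_closedBall (0:ℂ) 1).exists_isMaxOn hne hqc
  set m := ω₀ z1 / ω z1 with hm
  have hmpos : 0 < m := div_pos (h0pos z1 hz1) (hpos z1 hz1)
  have hlow : ∀ z ∈ unitDisk, Real.sqrt m ≤ ‖g z‖ := by
    intro z hz
    rw [Real.sqrt_le_left (norm_nonneg _), hsq z hz]
    exact hmin (Metric.ball_subset_closedBall hz)
  have hg0 : g 0 = ((Real.exp ((H 0).re/2) : ℝ) : ℂ) := by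
    have h1 : (H 0 - Complex.I * (H 0).im)/2 = (((H 0).re/2 : ℝ) : ℂ) := by
      apply Complex.ext <;> simp
    rw [Complex.ofReal_exp, ← h1]
  refine ⟨g, Real.exp ((H 0).re/2), Real.sqrt (ω₀ z2 / ω z2), hgd, fun z => Complex.exp_ne_zero _,
    ?_, Real.exp_pos _, hg0, ?_⟩
  · intro z hz
    apply Real.le_sqrt_of_sq_le
    rw [hsq z hz]
    exact hmax (Metric.ball_subset_closedBall hz)
  · rintro F hF ⟨M', hM'⟩
    have h1 := S3_var_bdd h (p := fun z => F z / g z) (M := M' / Real.sqrt m)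
      (hF.div hgd (fun z _ => Complex.exp_ne_zero _)) ?_
    · rw [← hg0, ← h1]
      apply setIntegral_congr_fun S3_meas_disk
      intro z hz
      have h2 := hpos z (Metric.ball_subset_closedBall hz)
      have h3 := hsq z hz
      have h4 : g z * (starRingEnd ℂ) (g z) = ((ω₀ z / ω z : ℝ) : ℂ) := by
        rw [Complex.mul_conj, Complex.normSq_eq_norm_sq, h3]
      have h5 : (ω z : ℂ) ≠ 0 := by exact_mod_cast h2.ne'
      have h6 : g z ≠ 0 := Complex.exp_ne_zero _
      have h7 : (ω₀ z : ℂ) = g z * (starRingEnd ℂ) (g z) * ω z := by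
        rw [h4]; push_cast; field_simp
      simp only [h7]
      field_simp
    · intro z hz
      rw [norm_div]
      exact div_le_div₀ ((norm_nonneg _).trans (hM' z hz)) (hM' z hz) (Real.sqrt_pos.2 hmpos) (hlow z hz)

/-- The conjugate of a function differentiable on the disk, reflected. -/
lemma S3_refl_diff {g : ℂ → ℂ} (hg : DifferentiableOn ℂ g unitDisk) :
    DifferentiableOn ℂ (fun z => (starRingEnd ℂ) (g ((starRingEnd ℂ) z))) unitDisk := by
  intro z hz
  have hz' : (starRingEnd ℂ) z ∈ unitDisk := by simpa [unitDisk] using hz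
  have h1 : DifferentiableAt ℂ g ((starRingEnd ℂ) z) :=
    (hg _ hz').differentiableAt (Metric.isOpen_ball.mem_nhds hz')
  have := h1.conj_conj
  simp only [Complex.conj_conj] at this
  exact this.differentiableWithinAt

lemma S3_conj_int (f : ℂ → ℂ) :
    ∫ z in unitDisk, f ((starRingEnd ℂ) z) ∂dSigma = ∫ z in unitDisk, f z ∂dSigma := by
  unfold dSigma
  rw [Measure.restrict_smul, integral_smul_measure, integral_smul_measure]
  congr 1
  have hmp : MeasurePreserving (Complex.conjLIE) volume volume :=
    Complex.conjLIE.measurePreserving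
  have := hmp.setIntegral_preimage_emb Complex.conjLIE.toHomeomorph.measurableEmbedding f unitDisk
  have hpre : (Complex.conjLIE) ⁻¹' unitDisk = unitDisk := by
    ext z; simp [unitDisk]
  rw [hpre] at this
  exact this

lemma S3_dS_int {E : Type*} [NormedAddCommGroup E] [NormedSpace ℝ E] (f : ℂ → E) :
    ∫ z in unitDisk, f z ∂dSigma = (1/Real.pi) • ∫ z in unitDisk, f z := by
  unfold dSigma
  rw [Measure.restrict_smul, integral_smul_measure, ENNReal.toReal_ofReal (by positivity)]

lemma S3_sym {ω : ℂ → ℝ} {g : ℂ → ℂ} {a M : ℝ} (hpos : ∀ z ∈ closedDisk, 0 < ω z)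
    (hc : ContinuousOn ω closedDisk) (hs : ∀ z ∈ unitDisk, ω ((starRingEnd ℂ) z) = ω z)
    (hgd : DifferentiableOn ℂ g unitDisk) (hgM : ∀ z ∈ unitDisk, ‖g z‖ ≤ M)
    (hrep : ∀ F : ℂ → ℂ, DifferentiableOn ℂ F unitDisk → (∃ M', ∀ z ∈ unitDisk, ‖F z‖ ≤ M') →
        ∫ z in unitDisk, F z * (starRingEnd ℂ) (g z) * (ω z : ℂ) ∂dSigma = F 0 / a) :
    ∀ z ∈ unitDisk, (starRingEnd ℂ) (g z) = g ((starRingEnd ℂ) z) := by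
  have hcm : ∀ z ∈ unitDisk, (starRingEnd ℂ) z ∈ unitDisk := fun z hz => by
    simpa [unitDisk] using hz
  set gs : ℂ → ℂ := fun z => (starRingEnd ℂ) (g ((starRingEnd ℂ) z)) with hgs
  have hgsd : DifferentiableOn ℂ gs unitDisk := S3_refl_diff hgd
  have hgsM : ∀ z ∈ unitDisk, ‖gs z‖ ≤ M := fun z hz => by
    simpa [hgs] using hgM _ (hcm z hz)
  set F : ℂ → ℂ := fun z => g z - gs z with hF
  have hFd : DifferentiableOn ℂ F unitDisk := hgd.sub hgsd
  have hFM : ∀ z ∈ unitDisk, ‖F z‖ ≤ M + M := fun z hz =>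
    (norm_sub_le _ _).trans (add_le_add (hgM z hz) (hgsM z hz))
  set Fs : ℂ → ℂ := fun z => (starRingEnd ℂ) (F ((starRingEnd ℂ) z)) with hFs
  have h1 := hrep F hFd ⟨_, hFM⟩
  have h2 := hrep Fs (S3_refl_diff hFd) ⟨M+M, fun z hz => by simpa [hFs] using hFM _ (hcm z hz)⟩
  have h3 : ∫ z in unitDisk, F z * (starRingEnd ℂ) (gs z) * (ω z : ℂ) ∂dSigma = F 0 / a := by
    have h4 := S3_conj_int (fun z => F z * (starRingEnd ℂ) (gs z) * (ω z : ℂ))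
    rw [← h4]
    have h5 : (starRingEnd ℂ) (∫ z in unitDisk, Fs z * (starRingEnd ℂ) (g z) * (ω z : ℂ) ∂dSigma)
        = (starRingEnd ℂ) (Fs 0 / a) := by rw [h2]
    rw [← integral_conj] at h5
    have h6 : (starRingEnd ℂ) (Fs 0 / a) = F 0 / a := by simp [hFs]
    rw [h6] at h5
    rw [← h5]
    apply setIntegral_congr_fun S3_meas_disk
    intro z hz
    simp [hFs, hgs, hs z hz]
  have hωc : ContinuousOn (fun z => (ω z : ℂ)) unitDisk :=
    Complex.continuous_ofReal.comp_continuousOn (hc.mono Metric.ball_subset_closedBall)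
  have hωi : IntegrableOn (fun z => (ω z : ℂ)) unitDisk dSigma :=
    S3_int (Complex.continuous_ofReal.comp_continuousOn hc)
  have hbi : ∀ k : ℂ → ℂ, ContinuousOn k unitDisk → (∀ z ∈ unitDisk, ‖k z‖ ≤ M) →
      IntegrableOn (fun z => F z * (starRingEnd ℂ) (k z) * (ω z : ℂ)) unitDisk dSigma := by
    intro k hk hkM
    apply hωi.bdd_mul (c := (M+M)*M)
    · exact (hFd.continuousOn.mul (Complex.continuous_conj.comp_continuousOn hk)).aestronglyMeasurable
        S3_meas_disk
    · filter_upwards [ae_restrict_mem S3_meas_disk] with z hz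
      rw [norm_mul, RCLike.norm_conj]
      exact mul_le_mul (hFM z hz) (hkM z hz) (norm_nonneg _) ((norm_nonneg _).trans (hFM z hz))
  have h7 : ∫ z in unitDisk, ((‖F z‖^2 * ω z : ℝ) : ℂ) ∂dSigma = 0 := by
    have : ∀ z, ((‖F z‖^2 * ω z : ℝ) : ℂ) = F z * (starRingEnd ℂ) (g z) * (ω z : ℂ) -
        F z * (starRingEnd ℂ) (gs z) * (ω z : ℂ) := by
      intro z
      rw [← sub_mul, ← mul_sub, ← map_sub, Complex.mul_conj, Complex.normSq_eq_norm_sq]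
      push_cast; rfl
    simp only [this]
    rw [integral_sub (hbi g hgd.continuousOn hgM) (hbi gs hgsd.continuousOn hgsM), h1, h3, sub_self]
  rw [integral_complex_ofReal, Complex.ofReal_eq_zero, S3_dS_int, smul_eq_zero] at h7
  have h7' := h7.resolve_left (by positivity)
  have hcF : ContinuousOn (fun z => ‖F z‖^2 * ω z) unitDisk :=
    (hFd.continuousOn.norm.pow 2).mul (hc.mono Metric.ball_subset_closedBall)
  have hIntg : IntegrableOn (fun z => ‖F z‖^2 * ω z) unitDisk volume := by
    have h8 : IntegrableOn ω unitDisk volume :=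
      (hc.integrableOn_compact (isCompact_closedBall _ _)).mono_set Metric.ball_subset_closedBall
    apply h8.bdd_mul (c := (M+M)^2)
    · exact (hFd.continuousOn.norm.pow 2).aestronglyMeasurable S3_meas_disk
    · filter_upwards [ae_restrict_mem S3_meas_disk] with z hz
      rw [norm_pow, norm_norm]
      exact pow_le_pow_left₀ (norm_nonneg _) (hFM z hz) 2
  have h9 := (setIntegral_eq_zero_iff_of_nonneg_ae (by
    filter_upwards [ae_restrict_mem S3_meas_disk] with z hz
    have := hpos z (Metric.ball_subset_closedBall hz)
    simp only [Pi.zero_apply]; positivity) hIntg).1 h7'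
  have h10 : EqOn (fun z => ‖F z‖^2 * ω z) 0 unitDisk :=
    Measure.eqOn_open_of_ae_eq h9 Metric.isOpen_ball hcF continuousOn_const
  intro z hz
  have h11 := h10 (hcm z hz)
  have h12 := hpos _ (Metric.ball_subset_closedBall (hcm z hz))
  simp only [Pi.zero_apply, mul_eq_zero, h12.ne', or_false] at h11
  have h13 : ‖F ((starRingEnd ℂ) z)‖ = 0 := by simpa using h11
  rw [norm_eq_zero] at h13
  simp only [hF, hgs, Complex.conj_conj] at h13
  exact (sub_eq_zero.1 h13).symm

lemma S3_pos_real {g : ℂ → ℂ} {a : ℝ} (hgd : DifferentiableOn ℂ g unitDisk) (hne : ∀ z, g z ≠ 0)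
    (ha : 0 < a) (h0 : g 0 = a)
    (hsym : ∀ z ∈ unitDisk, (starRingEnd ℂ) (g z) = g ((starRingEnd ℂ) z))
    {x : ℝ} (hx : |x| < 1) : (g x).im = 0 ∧ 0 < (g x).re := by
  have hmem : ∀ y : ℝ, |y| < 1 → (y : ℂ) ∈ unitDisk := fun y hy => by simpa [unitDisk] using hy
  have him : ∀ y : ℝ, |y| < 1 → (g y).im = 0 := by
    intro y hy
    have := hsym y (hmem y hy)
    rw [Complex.conj_ofReal] at this
    exact Complex.conj_eq_iff_im.1 this
  refine ⟨him x hx, ?_⟩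
  by_contra hcon
  push Not at hcon
  have hsub : ∀ y ∈ uIcc 0 x, |y| < 1 := by
    intro y hy
    have := abs_sub_left_of_mem_uIcc hy
    simp only [sub_zero] at this
    exact this.trans_lt hx
  have hcont : ContinuousOn (fun y : ℝ => (g y).re) (uIcc 0 x) := by
    apply Complex.continuous_re.comp_continuousOn
    exact hgd.continuousOn.comp (by fun_prop) (fun y hy => hmem y (hsub y hy))
  have hI := intermediate_value_uIcc hcont
  have h0m : (0:ℝ) ∈ uIcc ((g ((0:ℝ):ℂ)).re) ((g x).re) := by
    rw [mem_uIcc]; right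
    refine ⟨hcon, ?_⟩
    simp [h0, ha.le]
  obtain ⟨y, hy, hy0⟩ := hI h0m
  exact hne y (Complex.ext hy0 (him y (hsub y hy)))

/-- Conformal map of a large disk onto the strip. -/
def US (r : ℝ) (z : ℂ) : ℂ := Complex.log ((1 + r*z)/(1 - r*z))

/-- Derivative of the conformal map. -/
def US1 (r : ℝ) (z : ℂ) : ℂ := 2*r/(1 - r^2*z^2)

/-- Inverse of the conformal map. -/
def VS (r : ℝ) (u : ℂ) : ℂ := (Complex.exp u - 1)/((Complex.exp u + 1) * r)

lemma S3_normlt {w : ℂ} (hw : ‖w‖ < 1) : 1 - w ≠ 0 ∧ 1 + w ≠ 0 := by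
  constructor
  · intro h
    have : w = 1 := (sub_eq_zero.1 h).symm
    rw [this] at hw; simp at hw
  · intro h
    have : w = -1 := by linear_combination h
    rw [this] at hw; simp at hw

lemma S3_quot_re {w : ℂ} : ((1+w)/(1-w)).re = (1 - ‖w‖^2)/‖1-w‖^2 := by
  rw [Complex.div_re, ← Complex.normSq_eq_norm_sq, ← Complex.normSq_eq_norm_sq, ← add_div]
  congr 1
  simp [Complex.normSq_apply]; ring

lemma S3_quot_pos {w : ℂ} (hw : ‖w‖ < 1) : 0 < ((1+w)/(1-w)).re := by
  rw [S3_quot_re]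
  have := norm_pos_iff.2 (S3_normlt hw).1
  have h2 : ‖w‖^2 < 1 := by nlinarith [norm_nonneg w]
  apply div_pos (by linarith) (by positivity)

lemma S3_rz {r : ℝ} (hr : 0 < r) {z : ℂ} (hz : ‖z‖ < 1/r) : ‖(r:ℂ)*z‖ < 1 := by
  rw [norm_mul, Complex.norm_real, Real.norm_eq_abs, abs_of_pos hr]
  rw [lt_div_iff₀ hr] at hz; linarith

lemma US_im {r : ℝ} (hr : 0 < r) {z : ℂ} (hz : ‖z‖ < 1/r) : |(US r z).im| < Real.pi/2 := by
  have h := S3_quot_pos (S3_rz hr hz)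
  rw [US, Complex.log_im, Complex.abs_arg_lt_pi_div_two_iff]
  exact Or.inl h

lemma US_cos {r : ℝ} (hr : 0 < r) {z : ℂ} (hz : ‖z‖ < 1/r) :
    Real.cos (US r z).im = (1 - r^2*‖z‖^2)/‖1 - r^2*z^2‖ := by
  have hw := S3_rz hr hz
  obtain ⟨h1, h2⟩ := S3_normlt hw
  have h := S3_quot_pos hw
  have hne : (1+r*z)/(1-r*z) ≠ 0 := div_ne_zero h2 h1
  rw [US, Complex.log_im, Complex.cos_arg hne, S3_quot_re, norm_div]
  have h3 : ‖1 - (r:ℂ)^2*z^2‖ = ‖1-(r:ℂ)*z‖ * ‖1+(r:ℂ)*z‖ := by rw [← norm_mul]; congr 1; ring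
  rw [h3, norm_mul, Complex.norm_real, Real.norm_eq_abs, abs_of_pos hr]
  have := norm_pos_iff.2 h1
  have := norm_pos_iff.2 h2
  field_simp

lemma US_deriv {r : ℝ} (hr : 0 < r) {z : ℂ} (hz : ‖z‖ < 1/r) :
    HasDerivAt (US r) (US1 r z) z := by
  have hw := S3_rz hr hz
  obtain ⟨h1, h2⟩ := S3_normlt hw
  have h := S3_quot_pos hw
  have hd1 : HasDerivAt (fun z : ℂ => 1 + (r:ℂ)*z) r z := by
    simpa using ((hasDerivAt_id z).const_mul (r:ℂ)).const_add 1
  have hd2 : HasDerivAt (fun z : ℂ => 1 - (r:ℂ)*z) (-r) z := by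
    simpa using ((hasDerivAt_id z).const_mul (r:ℂ)).const_sub 1
  have := (hd1.div hd2 h1).clog (Or.inl h)
  refine this.congr_deriv ?_
  have h3 : 1 - (r:ℂ)^2*z^2 = (1-(r:ℂ)*z)*(1+(r:ℂ)*z) := by ring
  unfold US1
  rw [h3]
  simp only [Pi.div_apply]
  field_simp
  ring

lemma US1_ne {r : ℝ} (hr : 0 < r) {z : ℂ} (hz : ‖z‖ < 1/r) :
    US1 r z ≠ 0 ∧ 1 - (r:ℂ)^2*z^2 ≠ 0 := by
  obtain ⟨h1, h2⟩ := S3_normlt (S3_rz hr hz)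
  have h3 : 1 - (r:ℂ)^2*z^2 = (1-(r:ℂ)*z)*(1+(r:ℂ)*z) := by ring
  have h4 : 1 - (r:ℂ)^2*z^2 ≠ 0 := by rw [h3]; exact mul_ne_zero h1 h2
  refine ⟨?_, h4⟩
  unfold US1
  have : (r:ℂ) ≠ 0 := by exact_mod_cast hr.ne'
  exact div_ne_zero (mul_ne_zero two_ne_zero this) h4

lemma US1_diff {r : ℝ} (hr : 0 < r) {z : ℂ} (hz : ‖z‖ < 1/r) :
    DifferentiableAt ℂ (US1 r) z := by
  unfold US1
  exact (differentiableAt_const _).div (by fun_prop) (US1_ne hr hz).2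

lemma US_conj {r : ℝ} (hr : 0 < r) {z : ℂ} (hz : ‖z‖ < 1/r) :
    US r ((starRingEnd ℂ) z) = (starRingEnd ℂ) (US r z) := by
  have h := S3_quot_pos (S3_rz hr hz)
  unfold US
  rw [← Complex.log_conj]
  · simp
  · intro harg
    have := Complex.abs_arg_lt_pi_div_two_iff.2 (Or.inl h)
    rw [harg, abs_of_pos Real.pi_pos] at this
    linarith [Real.pi_pos]

lemma US1_conj (r : ℝ) (z : ℂ) : US1 r ((starRingEnd ℂ) z) = (starRingEnd ℂ) (US1 r z) := by
  simp [US1, Complex.conj_ofNat]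

lemma VS_conj (r : ℝ) (z : ℂ) : VS r ((starRingEnd ℂ) z) = (starRingEnd ℂ) (VS r z) := by
  simp [VS, Complex.exp_conj]

lemma S3_exp_strip {u : ℂ} (hu : u ∈ stripS) : 0 < (Complex.exp u).re := by
  rw [Complex.exp_re]
  have := Real.cos_pos_of_mem_Ioo (abs_lt.1 hu)
  positivity

lemma S3_exp_ne {u : ℂ} (hu : u ∈ stripS) : Complex.exp u + 1 ≠ 0 := by
  intro h
  have h1 := S3_exp_strip hu
  have h2 := congrArg Complex.re h
  simp only [Complex.add_re, Complex.one_re, Complex.zero_re] at h2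
  linarith

lemma VS_norm {r : ℝ} (hr : 0 < r) {u : ℂ} (hu : u ∈ stripS) : ‖VS r u‖ < 1/r := by
  have h1 := S3_exp_strip hu
  have h2 := norm_pos_iff.2 (S3_exp_ne hu)
  unfold VS
  rw [norm_div, norm_mul, Complex.norm_real, Real.norm_eq_abs, abs_of_pos hr,
    div_lt_div_iff₀ (by positivity) hr, one_mul]
  apply mul_lt_mul_of_pos_right _ hr
  rw [← sq_lt_sq₀ (norm_nonneg _) (norm_nonneg _), ← Complex.normSq_eq_norm_sq,
    ← Complex.normSq_eq_norm_sq, Complex.normSq_apply, Complex.normSq_apply]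
  simp only [Complex.sub_re, Complex.add_re, Complex.one_re, Complex.sub_im, Complex.add_im,
    Complex.one_im]
  nlinarith

lemma US_VS {r : ℝ} (hr : 0 < r) {u : ℂ} (hu : u ∈ stripS) : US r (VS r u) = u := by
  have h2 := S3_exp_ne hu
  have hr' : (r:ℂ) ≠ 0 := by exact_mod_cast hr.ne'
  have h3 : (r:ℂ) * VS r u = (Complex.exp u - 1)/(Complex.exp u + 1) := by
    unfold VS; field_simp
  have h4 : (1 + (r:ℂ) * VS r u)/(1 - (r:ℂ) * VS r u) = Complex.exp u := by
    have h5 : 1 - (r:ℂ) * VS r u = 2/(Complex.exp u + 1) := by rw [h3]; field_simp; ring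
    have h6 : 1 + (r:ℂ) * VS r u = 2*Complex.exp u/(Complex.exp u + 1) := by rw [h3]; field_simp; ring
    rw [h5, h6]; field_simp
  have hab := abs_lt.1 (show |u.im| < Real.pi/2 from hu)
  rw [US, h4, Complex.log_exp] <;> linarith [Real.pi_pos]

lemma VS_US {r : ℝ} (hr : 0 < r) {z : ℂ} (hz : ‖z‖ < 1/r) : VS r (US r z) = z := by
  obtain ⟨h1, h2⟩ := S3_normlt (S3_rz hr hz)
  have hr' : (r:ℂ) ≠ 0 := by exact_mod_cast hr.ne'
  unfold VS US
  rw [Complex.exp_log (div_ne_zero h2 h1)]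
  have h3 : (1 + (r:ℂ)*z)/(1-r*z) - 1 = 2*r*z/(1-r*z) := by field_simp; ring
  have h4 : (1 + (r:ℂ)*z)/(1-r*z) + 1 = 2/(1-r*z) := by field_simp; ring
  rw [h3, h4]; field_simp

lemma VS_diff {r : ℝ} (hr : 0 < r) {u : ℂ} (hu : u ∈ stripS) : DifferentiableAt ℂ (VS r) u := by
  have hr' : (r:ℂ) ≠ 0 := by exact_mod_cast hr.ne'
  unfold VS
  exact DifferentiableAt.div (by fun_prop) (by fun_prop) (mul_ne_zero (S3_exp_ne hu) hr')

lemma lapR_comp {U U1 : ℂ → ℂ} {s : Set ℂ} (hs : IsOpen s)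
    (hU : ∀ w ∈ s, HasDerivAt U (U1 w) w) {z : ℂ} (hz : z ∈ s) {U2 : ℂ} (hU1 : HasDerivAt U1 U2 z)
    {Φ Φ1 : ℝ → ℝ} {Φ2 : ℝ} (hΦ : ∀ w ∈ s, HasDerivAt Φ (Φ1 (U w).im) (U w).im)
    (hPhi : HasDerivAt Φ1 Φ2 (U z).im) :
    lapR (fun w => Φ (U w).im) z = (1/4) * (Φ2 * ‖U1 z‖^2) := by
  have him : ∀ w ∈ s, HasFDerivAt (fun w => (U w).im) (Complex.imCLM.comp (U1 w • (1 : ℂ →L[ℝ] ℂ))) w :=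
    fun w hw => Complex.imCLM.hasFDerivAt.comp w (hU w hw).complexToReal_fderiv
  have h1 : ∀ v : ℂ, ∀ w ∈ s, fderiv ℝ (fun w => Φ (U w).im) w v = Φ1 (U w).im * (U1 w * v).im := by
    intro v w hw
    have := (hΦ w hw).comp_hasFDerivAt w (him w hw)
    rw [show (fun w => Φ (U w).im) = Φ ∘ (fun w => (U w).im) from rfl, this.fderiv]
    simp
  have h2 : ∀ v : ℂ, fderiv ℝ (fun w => fderiv ℝ (fun w => Φ (U w).im) w v) z v =
      Φ2 * (U1 z * v).im * (U1 z * v).im + Φ1 (U z).im * (U2 * v * v).im := by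
    intro v
    have he : (fun w => fderiv ℝ (fun w => Φ (U w).im) w v) =ᶠ[nhds z]
        (fun w => Φ1 (U w).im * (U1 w * v).im) := by
      filter_upwards [hs.mem_nhds hz] with w hw
      exact h1 v w hw
    rw [he.fderiv_eq]
    have ha := hPhi.comp_hasFDerivAt z (him z hz)
    have hb : HasFDerivAt (fun w => (U1 w * v).im)
        (Complex.imCLM.comp ((U2 * v) • (1 : ℂ →L[ℝ] ℂ))) z :=
      Complex.imCLM.hasFDerivAt.comp z (hU1.mul_const v).complexToReal_fderiv
    have hc := ha.mul hb
    rw [show (fun w => Φ1 (U w).im * (U1 w * v).im) =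
      (Φ1 ∘ (fun w => (U w).im)) * (fun w => (U1 w * v).im) from rfl, hc.fderiv]
    simp
    ring
  unfold lapR
  rw [h2, h2, ← Complex.normSq_eq_norm_sq, Complex.normSq_apply]
  simp
  ring

/-- First derivative of the profile. -/
def rho1 (B b θ : ℝ) : ℝ := -Real.sin θ - (1/100)*Real.sin (3*θ) + B*b*Real.sinh (b*θ)

/-- Second derivative of the profile. -/
def rho2 (B b θ : ℝ) : ℝ := -Real.cos θ - (3/100) * Real.cos (3*θ) + B*b^2*Real.cosh (b*θ)

lemma rhoS_deriv (B b θ : ℝ) : HasDerivAt (rhoS B b) (rho1 B b θ) θ := by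
  have h3 : HasDerivAt (fun x : ℝ => 3*x) 3 θ := by simpa using (hasDerivAt_id θ).const_mul (3:ℝ)
  have hb : HasDerivAt (fun x : ℝ => b*x) b θ := by simpa using (hasDerivAt_id θ).const_mul b
  have := ((Real.hasDerivAt_cos θ).add (h3.cos.const_mul (1/300))).add (hb.cosh.const_mul B)
  refine (this.congr_deriv ?_)
  unfold rho1; ring

lemma rho1_deriv (B b θ : ℝ) : HasDerivAt (rho1 B b) (rho2 B b θ) θ := by
  have h3 : HasDerivAt (fun x : ℝ => 3*x) 3 θ := by simpa using (hasDerivAt_id θ).const_mul (3:ℝ)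
  have hb : HasDerivAt (fun x : ℝ => b*x) b θ := by simpa using (hasDerivAt_id θ).const_mul b
  have := ((Real.hasDerivAt_sin θ).neg.sub (h3.sin.const_mul (1/100))).add (hb.sinh.const_mul (B*b))
  refine (this.congr_deriv ?_)
  unfold rho2; ring

lemma rhoS_smooth (B b : ℝ) : ContDiff ℝ (⊤ : ℕ∞) (rhoS B b) := by
  unfold rhoS; fun_prop
lemma rho1_smooth (B b : ℝ) : ContDiff ℝ (⊤ : ℕ∞) (rho1 B b) := by
  unfold rho1; fun_prop
lemma rho2_smooth (B b : ℝ) : ContDiff ℝ (⊤ : ℕ∞) (rho2 B b) := by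
  unfold rho2; fun_prop

/-- The weight. -/
def omS (B b r : ℝ) (z : ℂ) : ℝ := rhoS B b (US r z).im

/-- The curvature data. -/
def muS (B b r : ℝ) (z : ℂ) : ℝ :=
  -(1/2) * (((rho2 B b (US r z).im * rhoS B b (US r z).im - rho1 B b (US r z).im ^ 2)
    / (rhoS B b (US r z).im)^2) * ‖US1 r z‖^2)

lemma S3_cd_ball {r : ℝ} (hr : 0 < r) (hr1 : r < 1) {z : ℂ} (hz : z ∈ closedDisk) : ‖z‖ < 1/r := by
  simp only [closedDisk, mem_closedBall_zero_iff] at hz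
  rw [lt_div_iff₀ hr]; nlinarith [norm_nonneg z]

lemma omS_pos {B b r : ℝ} (hB : 0 < B) (hr : 0 < r) {z : ℂ} (hz : ‖z‖ < 1/r) :
    0 < omS B b r z := hB.trans_le (rhoS_ge b hB (US_im hr hz).le)

lemma US_im_smooth {r : ℝ} (hr : 0 < r) :
    ContDiffOn ℝ (⊤ : ℕ∞) (fun z => (US r z).im) (Metric.ball 0 (1/r)) := by
  have h : DifferentiableOn ℂ (US r) (Metric.ball 0 (1/r)) := fun z hz =>
    (US_deriv hr (by simpa using hz)).differentiableAt.differentiableWithinAt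
  have h1 : ContDiffOn ℂ (⊤ : ℕ∞) (US r) (Metric.ball 0 (1/r)) := h.contDiffOn Metric.isOpen_ball
  have h2 : ContDiffOn ℝ (⊤ : ℕ∞) (US r) (Metric.ball 0 (1/r)) := h1.restrict_scalars ℝ
  exact Complex.imCLM.contDiff.comp_contDiffOn h2

lemma omS_smooth (B b : ℝ) {r : ℝ} (hr : 0 < r) :
    ContDiffOn ℝ (⊤ : ℕ∞) (omS B b r) (Metric.ball 0 (1/r)) :=
  (rhoS_smooth B b).comp_contDiffOn (US_im_smooth hr)

lemma muS_smooth {B : ℝ} (b : ℝ) {r : ℝ} (hB : 0 < B) (hr : 0 < r) :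
    ContDiffOn ℝ (⊤ : ℕ∞) (muS B b r) (Metric.ball 0 (1/r)) := by
  have h0 := omS_smooth B b hr
  have h1 := (rho1_smooth B b).comp_contDiffOn (US_im_smooth hr)
  have h2 := (rho2_smooth B b).comp_contDiffOn (US_im_smooth hr)
  have hd : DifferentiableOn ℂ (US1 r) (Metric.ball 0 (1/r)) := fun z hz =>
    (US1_diff hr (by simpa using hz)).differentiableWithinAt
  have h3 : ContDiffOn ℂ (⊤ : ℕ∞) (US1 r) (Metric.ball 0 (1/r)) := hd.contDiffOn Metric.isOpen_ball
  have h4 : ContDiffOn ℝ (⊤ : ℕ∞) (US1 r) (Metric.ball 0 (1/r)) := h3.restrict_scalars ℝ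
  have h5 : ContDiffOn ℝ (⊤ : ℕ∞) (fun z => ‖US1 r z‖^2) (Metric.ball 0 (1/r)) := h4.norm_sq ℝ
  exact contDiffOn_const.mul ((((h2.mul h0).sub (h1.pow 2)).div (h0.pow 2) (fun z hz =>
    pow_ne_zero 2 (omS_pos (b := b) hB hr (by simpa using hz)).ne')).mul h5)

lemma omS_lap {B : ℝ} (b : ℝ) {r : ℝ} (hB : 0 < B) (hr : 0 < r) {z : ℂ} (hz : ‖z‖ < 1/r) :
    lapR (fun z => Real.log (omS B b r z)) z = - muS B b r z / 2 := by
  have hpos : ∀ w ∈ Metric.ball (0:ℂ) (1/r), 0 < rhoS B b (US r w).im := fun w hw =>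
    omS_pos hB hr (by simpa using hw)
  have hzb : z ∈ Metric.ball (0:ℂ) (1/r) := by simpa using hz
  have := lapR_comp (U := US r) (U1 := US1 r) (s := Metric.ball 0 (1/r)) Metric.isOpen_ball
    (fun w hw => US_deriv hr (by simpa using hw)) hzb (US1_diff hr hz).hasDerivAt
    (Φ := fun t => Real.log (rhoS B b t)) (Φ1 := fun t => rho1 B b t / rhoS B b t)
    (Φ2 := (rho2 B b (US r z).im * rhoS B b (US r z).im - rho1 B b (US r z).im * rho1 B b (US r z).im)
    / (rhoS B b (US r z).im)^2)
    (fun w hw => (rhoS_deriv B b _).log (hpos w hw).ne')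
    ((rho1_deriv B b _).div (rhoS_deriv B b _) (hpos z hzb).ne')
  unfold omS
  rw [this]
  unfold muS
  ring

lemma muS_le {B : ℝ} (b : ℝ) {r : ℝ} (hB : 0 < B) (hr : 0 < r) (hr1 : r < 1) {z : ℂ} (hz : ‖z‖ < 1) :
    muS B b r z ≤ 2 * (26/25) / (1 - ‖z‖^2)^2 := by
  have hz' : ‖z‖ < 1/r := by rw [lt_div_iff₀ hr]; nlinarith [norm_nonneg z]
  have hcos := US_cos hr hz'
  have hne := norm_pos_iff.2 (US1_ne hr hz').2
  have hz2 : ‖z‖^2 < 1 := by nlinarith [norm_nonneg z]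
  have hnum : 0 < 1 - r^2*‖z‖^2 := by nlinarith [sq_nonneg r, sq_nonneg ‖z‖]
  have hcp : 0 < Real.cos (US r z).im := by rw [hcos]; positivity
  have hcur := rhoS_curv (B := B) b hB hcp
  have hρ : 0 < rhoS B b (US r z).im := omS_pos hB hr hz'
  have hU1 : ‖US1 r z‖ = 2*r/‖1 - (r:ℂ)^2*z^2‖ := by
    unfold US1
    rw [norm_div, norm_mul, Complex.norm_real, Real.norm_eq_abs, abs_of_pos hr]; simp
  unfold muS
  set ρ := rhoS B b (US r z).im
  set K := rho2 B b (US r z).im * ρ - rho1 B b (US r z).im ^ 2 with hK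
  set N := ‖1 - (r:ℂ)^2*z^2‖
  set C := Real.cos (US r z).im
  have hKc : -(26/25) * ρ^2 ≤ C^2 * K := by
    have : K = ρ * (-Real.cos (US r z).im - (3/100)*Real.cos (3*(US r z).im) + B*b^2*Real.cosh (b*(US r z).im)) - (-Real.sin (US r z).im - (1/100)*Real.sin (3*(US r z).im) + B*b*Real.sinh (b*(US r z).im))^2 := by
      rw [hK]; unfold rho2 rho1; ring
    rw [this]; exact hcur
  have h1 : -(26/25) / C^2 ≤ K/ρ^2 := by
    rw [div_le_div_iff₀ (by positivity) (by positivity)]; linarith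
  have h2 : -(1/2) * (K/ρ^2 * ‖US1 r z‖^2) ≤ (1/2) * ((26/25)/C^2 * ‖US1 r z‖^2) := by
    have := mul_le_mul_of_nonneg_right h1 (sq_nonneg ‖US1 r z‖)
    rw [neg_div, neg_mul] at this
    linarith
  refine h2.trans ?_
  rw [hU1, hcos]
  have h3 : (1/2) * ((26/25)/((1 - r^2*‖z‖^2)/N)^2 * (2*r/N)^2) = 2*(26/25) * (r/(1 - r^2*‖z‖^2))^2 := by
    field_simp
  rw [h3, show 2*(26/25)/(1-‖z‖^2)^2 = 2*(26/25) * (1/(1-‖z‖^2))^2 by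
    rw [one_div, inv_pow, ← div_eq_mul_inv]]
  apply mul_le_mul_of_nonneg_left _ (by norm_num)
  apply pow_le_pow_left₀ (by positivity)
  have h4 : 0 < 1 - ‖z‖^2 := by linarith
  rw [div_le_div_iff₀ hnum h4]
  nlinarith [sq_nonneg ‖z‖, mul_pos hr (sub_pos.2 hr1)]

lemma S3_det (c : ℂ) : |(c • (1 : ℂ →L[ℝ] ℂ)).det| = ‖c‖^2 := by
  have h1 : ((c • (1 : ℂ →L[ℝ] ℂ) : ℂ →L[ℝ] ℂ) : ℂ →ₗ[ℝ] ℂ) = Algebra.lmul ℝ ℂ c := by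
    ext <;> simp
  unfold ContinuousLinearMap.det
  rw [h1, ← Algebra.norm_apply, Algebra.norm_complex_apply, Complex.normSq_eq_norm_sq,
    abs_of_nonneg (sq_nonneg _)]

/-- The image of the disk in the strip. -/
def OmS (r : ℝ) : Set ℂ := {u | u ∈ stripS ∧ ‖VS r u‖ < 1}

lemma S3_ud {r : ℝ} (hr : 0 < r) (hr1 : r < 1) {z : ℂ} (hz : z ∈ unitDisk) : ‖z‖ < 1/r :=
  S3_cd_ball hr hr1 (Metric.ball_subset_closedBall hz)

lemma OmS_image {r : ℝ} (hr : 0 < r) (hr1 : r < 1) : US r '' unitDisk = OmS r := by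
  ext u
  constructor
  · rintro ⟨z, hz, rfl⟩
    have h := S3_ud hr hr1 hz
    refine ⟨US_im hr h, ?_⟩
    rw [VS_US hr h]
    simpa [unitDisk] using hz
  · rintro ⟨h1, h2⟩
    exact ⟨VS r u, by simpa [unitDisk] using h2, US_VS hr h1⟩

lemma OmS_open {r : ℝ} (hr : 0 < r) : IsOpen (OmS r) := by
  have hc : ContinuousOn (VS r) stripS := fun u hu => (VS_diff hr hu).continuousAt.continuousWithinAt
  have := hc.isOpen_inter_preimage stripS_open (Metric.isOpen_ball (x := (0:ℂ)) (ε := 1))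
  convert this using 1
  ext u; simp [OmS]

lemma US_inj {r : ℝ} (hr : 0 < r) (hr1 : r < 1) : InjOn (US r) unitDisk := by
  intro z hz w hw h
  rw [← VS_US hr (S3_ud hr hr1 hz), h, VS_US hr (S3_ud hr hr1 hw)]

lemma S3_cov {r : ℝ} (hr : 0 < r) (hr1 : r < 1) {E : Type*} [NormedAddCommGroup E] [NormedSpace ℝ E]
    (G : ℂ → E) : ∫ u in OmS r, G u = ∫ z in unitDisk, (‖US1 r z‖^2) • G (US r z) := by
  rw [← OmS_image hr hr1, integral_image_eq_integral_abs_det_fderiv_smul volume S3_meas_disk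
    (fun z hz => (US_deriv hr (S3_ud hr hr1 hz)).complexToReal_fderiv.hasFDerivWithinAt)
    (US_inj hr hr1)]
  simp only [S3_det]

lemma S3_cov_int {r : ℝ} (hr : 0 < r) (hr1 : r < 1) {E : Type*} [NormedAddCommGroup E] [NormedSpace ℝ E]
    (G : ℂ → E) : IntegrableOn G (OmS r) ↔
      IntegrableOn (fun z => (‖US1 r z‖^2) • G (US r z)) unitDisk := by
  rw [← OmS_image hr hr1, integrableOn_image_iff_integrableOn_abs_det_fderiv_smul volume S3_meas_disk
    (fun z hz => (US_deriv hr (S3_ud hr hr1 hz)).complexToReal_fderiv.hasFDerivWithinAt)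
    (US_inj hr hr1)]
  simp only [S3_det]

lemma S3_transfer {B b ε L r a M : ℝ} (hB : 0 < B) (hL : 2 ≤ L) (hr : 0 < r) (hr1 : r < 1)
    (hcore : ∀ (Ω : Set ℂ) (g : ℂ → ℂ), IsOpen Ω → Ω ⊆ stripS →
      rectS (L+1) (Real.pi/2 - 1/L) ⊆ Ω → DifferentiableOn ℂ g Ω →
      IntegrableOn (fun u => ‖g u‖^2 * rhoS B b u.im) Ω →
      (∀ u ∈ rectS (L+1) (Real.pi/2 - 1/L), (starRingEnd ℂ) (g u) = g ((starRingEnd ℂ) u)) →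
      (∀ x : ℝ, |x| ≤ L → 0 ≤ (g x).re) → g 0 = 1 →
      (∫ u in Ω, fS ε u * (starRingEnd ℂ) (g u) * (rhoS B b u.im : ℂ) =
        -((∫ u in Ω, ‖g u‖^2 * rhoS B b u.im : ℝ) : ℂ)) → False)
    (hrect : rectS (L+1) (Real.pi/2 - 1/L) ⊆ OmS r)
    {g0 : ℂ → ℂ} (hgd : DifferentiableOn ℂ g0 unitDisk) (hne : ∀ z, g0 z ≠ 0)
    (hgM : ∀ z ∈ unitDisk, ‖g0 z‖ ≤ M) (ha : 0 < a) (hg0 : g0 0 = a)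
    (hrep : ∀ F : ℂ → ℂ, DifferentiableOn ℂ F unitDisk → (∃ M', ∀ z ∈ unitDisk, ‖F z‖ ≤ M') →
        ∫ z in unitDisk, F z * (starRingEnd ℂ) (g0 z) * (omS B b r z : ℂ) ∂dSigma = F 0 / a) :
    False := by
  have hud : ∀ z ∈ unitDisk, ‖z‖ < 1/r := fun z hz => S3_ud hr hr1 hz
  have hr' : (r:ℂ) ≠ 0 := by exact_mod_cast hr.ne'
  have ha' : (a:ℂ) ≠ 0 := by exact_mod_cast ha.ne'
  have hcdb : closedDisk ⊆ Metric.ball (0:ℂ) (1/r) := fun z hz => by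
    simpa using S3_cd_ball hr hr1 hz
  have hωc : ContinuousOn (omS B b r) closedDisk := (omS_smooth B b hr).continuousOn.mono hcdb
  have hωp : ∀ z ∈ closedDisk, 0 < omS B b r z := fun z hz => omS_pos hB hr (S3_cd_ball hr hr1 hz)
  have hsym : ∀ z ∈ unitDisk, (starRingEnd ℂ) (g0 z) = g0 ((starRingEnd ℂ) z) := by
    refine S3_sym hωp hωc ?_ hgd hgM hrep
    intro z hz
    unfold omS
    rw [US_conj hr (hud z hz), Complex.conj_im, rhoS_even]
  set c : ℝ := 2*r/a with hc
  have hcpos : 0 < c := by positivity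
  set g : ℂ → ℂ := fun u => g0 (VS r u) * c / US1 r (VS r u) with hg
  have hVD : ∀ u ∈ OmS r, VS r u ∈ unitDisk := fun u hu => by simpa [unitDisk] using hu.2
  have hgU : ∀ z ∈ unitDisk, g (US r z) = g0 z * c / US1 r z := by
    intro z hz; simp only [hg, VS_US hr (hud z hz)]
  have hpi : (0:ℝ) < Real.pi := Real.pi_pos
  have hnorm : ∀ z ∈ unitDisk, ‖US1 r z‖^2 * (‖g (US r z)‖^2 * rhoS B b (US r z).im) =
      c^2 * (‖g0 z‖^2 * omS B b r z) := by
    intro z hz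
    have := norm_pos_iff.2 (US1_ne hr (hud z hz)).1
    rw [hgU z hz, norm_div, norm_mul, Complex.norm_real, Real.norm_eq_abs, abs_of_pos hcpos]
    unfold omS
    field_simp
  have hI2 : ∫ u in OmS r, ‖g u‖^2 * rhoS B b u.im = c^2 * Real.pi := by
    rw [S3_cov hr hr1]
    have h1 := hrep g0 hgd ⟨M, hgM⟩
    rw [hg0, div_self ha', S3_dS_int] at h1
    have h2 : ∫ z in unitDisk, g0 z * (starRingEnd ℂ) (g0 z) * (omS B b r z : ℂ) =
        ((∫ z in unitDisk, ‖g0 z‖^2 * omS B b r z : ℝ) : ℂ) := by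
      rw [← integral_complex_ofReal]
      congr 1; ext z
      rw [Complex.mul_conj, Complex.normSq_eq_norm_sq]; push_cast; rfl
    rw [h2, Complex.real_smul, ← Complex.ofReal_mul] at h1
    have h3 : 1/Real.pi * ∫ z in unitDisk, ‖g0 z‖^2 * omS B b r z = 1 := by exact_mod_cast h1
    have h4 : ∫ z in unitDisk, ‖g0 z‖^2 * omS B b r z = Real.pi := by
      field_simp at h3; exact h3
    rw [← h4, ← integral_const_mul]
    apply setIntegral_congr_fun S3_meas_disk
    intro z hz
    simpa only [smul_eq_mul] using hnorm z hz
  have hIntg : IntegrableOn (fun u => ‖g u‖^2 * rhoS B b u.im) (OmS r) := by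
    rw [S3_cov_int hr hr1]
    have h8 : IntegrableOn (omS B b r) unitDisk volume :=
      (hωc.integrableOn_compact (isCompact_closedBall _ _)).mono_set Metric.ball_subset_closedBall
    have h9 : IntegrableOn (fun z => c^2 * (‖g0 z‖^2 * omS B b r z)) unitDisk volume := by
      apply Integrable.const_mul
      apply h8.bdd_mul (c := M^2)
      · exact (hgd.continuousOn.norm.pow 2).aestronglyMeasurable S3_meas_disk
      · filter_upwards [ae_restrict_mem S3_meas_disk] with z hz
        rw [norm_pow, norm_norm]
        exact pow_le_pow_left₀ (norm_nonneg _) (hgM z hz) 2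
    refine h9.congr_fun ?_ S3_meas_disk
    intro z hz
    simpa only [smul_eq_mul] using (hnorm z hz).symm
  have hUd : DifferentiableOn ℂ (US r) (Metric.ball 0 (1/r)) := fun z hz =>
    (US_deriv hr (by simpa using hz)).differentiableAt.differentiableWithinAt
  have hU1d : DifferentiableOn ℂ (US1 r) (Metric.ball 0 (1/r)) := fun z hz =>
    (US1_diff hr (by simpa using hz)).differentiableWithinAt
  have hFd : DifferentiableOn ℂ (fun z => fS ε (US r z) * US1 r z) (Metric.ball 0 (1/r)) :=
    ((fS_diff ε).comp_differentiableOn hUd).mul hU1d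
  have hU0 : US r 0 = 0 := by simp [US]
  have hU10 : US1 r 0 = 2*r := by simp [US1]
  have hV0 : VS r 0 = 0 := by simp [VS]
  have hI1 : ∫ u in OmS r, fS ε u * (starRingEnd ℂ) (g u) * (rhoS B b u.im : ℂ) =
      -((c^2 * Real.pi : ℝ) : ℂ) := by
    rw [S3_cov hr hr1]
    obtain ⟨M', hM'⟩ := (isCompact_closedBall (0:ℂ) 1).exists_bound_of_continuousOn
      (hFd.continuousOn.mono hcdb)
    have h1 := hrep (fun z => fS ε (US r z) * US1 r z)
      (hFd.mono (Metric.ball_subset_closedBall.trans hcdb))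
      ⟨M', fun z hz => hM' z (Metric.ball_subset_closedBall hz)⟩
    rw [hU0, fS_zero, hU10, S3_dS_int, Complex.real_smul] at h1
    have h2 : ∫ z in unitDisk, ‖US1 r z‖^2 • (fS ε (US r z) * (starRingEnd ℂ) (g (US r z)) *
        (rhoS B b (US r z).im : ℂ)) = c * ∫ z in unitDisk, fS ε (US r z) * US1 r z *
          (starRingEnd ℂ) (g0 z) * (omS B b r z : ℂ) := by
      rw [← integral_const_mul]
      apply setIntegral_congr_fun S3_meas_disk
      intro z hz
      have h3 := (US1_ne hr (hud z hz)).1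
      have h4 : (starRingEnd ℂ) (US1 r z) ≠ 0 := by simpa using h3
      simp only [hgU z hz, Complex.real_smul, map_div₀, map_mul, Complex.conj_ofReal]
      rw [← Complex.normSq_eq_norm_sq, ← Complex.mul_conj]
      unfold omS
      field_simp
    rw [h2]
    have hpi' : (Real.pi : ℂ) ≠ 0 := by exact_mod_cast hpi.ne'
    have h5 : ∫ z in unitDisk, fS ε (US r z) * US1 r z *
          (starRingEnd ℂ) (g0 z) * (omS B b r z : ℂ) = Real.pi * (-1 * (2*r)/a) := by
      rw [← h1]; push_cast; field_simp
    rw [h5, hc]; push_cast; field_simp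
  refine hcore (OmS r) g (OmS_open hr) (fun u hu => hu.1) hrect ?_ hIntg ?_ ?_ ?_ (by rw [hI1, hI2])
  · intro u hu
    have hV := VS_diff hr hu.1
    have h1 : DifferentiableAt ℂ g0 (VS r u) :=
      (hgd _ (hVD u hu)).differentiableAt (Metric.isOpen_ball.mem_nhds (hVD u hu))
    have h2 := US1_diff hr (hud _ (hVD u hu))
    exact (((h1.comp u hV).mul_const _).div (h2.comp u hV)
      (US1_ne hr (hud _ (hVD u hu))).1).differentiableWithinAt
  · intro u hu
    have := hsym _ (hVD u (hrect hu))
    simp only [hg, VS_conj, US1_conj, map_div₀, map_mul, Complex.conj_ofReal, this]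
  · intro x hx
    have hx1 : (x:ℂ) ∈ OmS r := by
      apply hrect
      refine ⟨by simp; linarith, ?_⟩
      simp only [Complex.ofReal_im, abs_zero]
      have : 1/L ≤ 1/2 := one_div_le_one_div_of_le (by norm_num) hL
      linarith [Real.pi_gt_three]
    obtain ⟨y, hy⟩ : ∃ y : ℝ, VS r x = y := by
      refine ⟨(VS r x).re, ?_⟩
      have h1 := VS_conj r x
      rw [Complex.conj_ofReal] at h1
      exact (Complex.conj_eq_iff_re.1 h1.symm).symm
    have hy1 : |y| < 1 := by
      have := hx1.2; rw [hy] at this; simpa using this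
    obtain ⟨h1, h2⟩ := S3_pos_real hgd hne ha hg0 hsym hy1
    have h3 : US1 r y = ((2*r/(1 - r^2*y^2) : ℝ) : ℂ) := by unfold US1; push_cast; rfl
    have h4 : g0 y = (((g0 y).re : ℝ) : ℂ) := Complex.ext (by simp) (by simp [h1])
    have h5 : g x = (((g0 y).re * c / (2*r/(1 - r^2*y^2)) : ℝ) : ℂ) := by
      simp only [hg, hy, h3]
      rw [h4]; push_cast; simp
    rw [h5, Complex.ofReal_re]
    have h6 : r^2*y^2 < 1 := by
      have : y^2 < 1 := by rw [← sq_abs]; nlinarith [abs_nonneg y]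
      nlinarith [sq_nonneg y]
    have h7 : 0 < 1 - r^2*y^2 := by linarith
    positivity
  · simp only [hg, hV0, hg0, hU10, hc]
    push_cast; field_simp

lemma S3_choose_r {L : ℝ} (hL : 2 ≤ L) : ∃ r : ℝ, 0 < r ∧ r < 1 ∧
    rectS (L+1) (Real.pi/2 - 1/L) ⊆ OmS r := by
  have hK : IsCompact (rectS (L+1) (Real.pi/2 - 1/L)) := by
    apply Metric.isCompact_of_isClosed_isBounded
    · exact (isClosed_le (f := fun u : ℂ => |u.re|) (by fun_prop) continuous_const).inter
        (isClosed_le (f := fun u : ℂ => |u.im|) (by fun_prop) continuous_const)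
    · apply (Metric.isBounded_closedBall (x := (0:ℂ)) (r := (L+1) + (Real.pi/2 - 1/L))).subset
      intro u hu
      rw [mem_closedBall_zero_iff]
      exact (Complex.norm_le_abs_re_add_abs_im u).trans (add_le_add hu.1 hu.2)
  have hst : rectS (L+1) (Real.pi/2 - 1/L) ⊆ stripS := by
    intro u hu
    have h1 : 0 < 1/L := by positivity
    have := hu.2
    show |u.im| < Real.pi/2
    linarith
  have hne : (rectS (L+1) (Real.pi/2 - 1/L)).Nonempty := by
    refine ⟨0, by simp; linarith, ?_⟩
    simp only [Complex.zero_im, abs_zero]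
    have : 1/L ≤ 1/2 := one_div_le_one_div_of_le (by norm_num) hL
    linarith [Real.pi_gt_three]
  have hc : ContinuousOn (fun u => ‖VS 1 u‖) (rectS (L+1) (Real.pi/2 - 1/L)) := fun u hu =>
    (VS_diff one_pos (hst hu)).continuousAt.norm.continuousWithinAt
  obtain ⟨u0, hu0, hmax⟩ := hK.exists_isMaxOn hne hc
  have h1 : ‖VS 1 u0‖ < 1 := by simpa using VS_norm one_pos (hst hu0)
  refine ⟨(1 + ‖VS 1 u0‖)/2, by positivity, by linarith, fun u hu => ⟨hst hu, ?_⟩⟩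
  have hr : 0 < (1 + ‖VS 1 u0‖)/2 := by positivity
  have h2 : ‖VS 1 u‖ ≤ ‖VS 1 u0‖ := hmax hu
  have h3 : VS ((1 + ‖VS 1 u0‖)/2) u = VS 1 u / (((1 + ‖VS 1 u0‖)/2 : ℝ) : ℂ) := by
    unfold VS; simp only [Complex.ofReal_one, mul_one, div_div]
  rw [h3, norm_div, Complex.norm_real, Real.norm_eq_abs, abs_of_pos hr, div_lt_one hr]
  linarith

/-- For every α ≥ 1.04 there is smooth data μ with
μ(z) ≤ 2α/(1-|z|²)² on 𝔻 for which the optimization problem (OP) has no strictly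
positive smooth solution ω₀ on the closed disk. -/
theorem statement3 : ∀ α : ℝ, 1.04 ≤ α →
    ∃ μ : ℂ → ℝ, ContDiffOn ℝ (⊤ : ℕ∞) μ closedDisk ∧
      (∀ z ∈ unitDisk, μ z ≤ 2 * α / (1 - ‖z‖ ^ 2) ^ 2) ∧
      ¬ ∃ ω₀ : ℂ → ℝ,
          (∀ z ∈ closedDisk, 0 < ω₀ z) ∧ ContDiffOn ℝ (⊤ : ℕ∞) ω₀ closedDisk ∧
          (∀ z ∈ unitDisk, lapR (fun z => Real.log (ω₀ z)) z = -μ z / 2) ∧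
          (∫ z in unitDisk, ω₀ z ∂dSigma) = 1 ∧
          (∀ ω : ℂ → ℝ, (∀ z ∈ closedDisk, 0 < ω z) → ContDiffOn ℝ (⊤ : ℕ∞) ω closedDisk →
            (∀ z ∈ unitDisk, lapR (fun z => Real.log (ω z)) z = -μ z / 2) →
            (∫ z in unitDisk, ω z ∂dSigma) = 1 → ω 0 ≤ ω₀ 0) := by
  intro α hα
  obtain ⟨B, b, ε, L, hB, hL, hcore⟩ := S3_strip_core
  obtain ⟨r, hr, hr1, hrect⟩ := S3_choose_r hL
  have hcdb : closedDisk ⊆ Metric.ball (0:ℂ) (1/r) := fun z hz => by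
    simpa using S3_cd_ball hr hr1 hz
  refine ⟨muS B b r, (muS_smooth b hB hr).mono hcdb, ?_, ?_⟩
  · intro z hz
    have hz1 : ‖z‖ < 1 := by simpa [unitDisk] using hz
    refine (muS_le b hB hr hr1 hz1).trans ?_
    apply div_le_div_of_nonneg_right _ (by positivity)
    norm_num at hα ⊢; linarith
  · rintro ⟨ω₀, h⟩
    have h' : S3Opt (muS B b r) ω₀ := h
    obtain ⟨g0, a, M, hgd, hne, hgM, ha, hg0, hrep⟩ := S3_rep h'
      (fun z hz => omS_pos (b := b) hB hr (S3_cd_ball hr hr1 hz))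
      ((omS_smooth B b hr).mono hcdb)
      (fun z hz => omS_lap b hB hr (S3_ud hr hr1 hz))
    exact S3_transfer hB hL hr hr1 hcore hrect hgd hne hgM ha hg0 hrep

end
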